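/- arXiv:2412.15096 — 2 statements merged into one kernel-verified Lean document; each statement's English description precedes it below -/
import Mathlib

section
/- Let Γ ⊂ P^n, n ≥ 2, be a finite subscheme of degree d ≥ 4n² + 6n + 1 in linearly general position over an algebraically closed field of characteristic 0, and suppose n divides d − 2 (i.e., d = nq + 2). If reg(Γ) = ⌈(d−1)/n⌉ + 1, then Γ lies on a rational normal curve of degree n, and hence Γ is in uniform position. -/
open MvPolynomial Filter
open scoped Classical

attribute [local instance] MvPolynomial.gradedAlgebra

noncomputable section

variable {K : Type} [Field K] {n : ℕ}

/-- The Hilbert function, in degree `m`, of the quotient of the homogeneous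
coordinate ring of `ℙ^n_K` by the ideal `I`. -/
def hilbF (I : Ideal (MvPolynomial (Fin (n+1)) K)) (m : ℕ) : ℕ :=
  Module.finrank K
    ((MvPolynomial.homogeneousSubmodule (Fin (n+1)) K m).map
      (Ideal.Quotient.mkₐ K I).toLinearMap)

/-- The irrelevant maximal ideal `(x_0, …, x_n)`. -/
def irrelevantIdeal (K : Type) [Field K] (n : ℕ) : Ideal (MvPolynomial (Fin (n+1)) K) :=
  Ideal.span (Set.range MvPolynomial.X)

/-- Saturation of a homogeneous ideal with respect to the irrelevant ideal. -/
def saturate (I : Ideal (MvPolynomial (Fin (n+1)) K)) : Ideal (MvPolynomial (Fin (n+1)) K) :=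
  ⨆ k : ℕ, Submodule.colon I ((irrelevantIdeal K n ^ k : Ideal (MvPolynomial (Fin (n+1)) K)) : Submodule (MvPolynomial (Fin (n+1)) K) (MvPolynomial (Fin (n+1)) K))

/-- `I` is the (saturated, homogeneous) ideal of a nonempty finite closed subscheme of
`ℙ^n`, i.e. its Hilbert function is eventually a positive constant. -/
structure IsFiniteSubscheme (I : Ideal (MvPolynomial (Fin (n+1)) K)) : Prop where
  homog : Ideal.IsHomogeneous (MvPolynomial.homogeneousSubmodule (Fin (n+1)) K) I
  saturated : saturate I = I
  finite : ∃ d : ℕ, 0 < d ∧ ∀ᶠ m : ℕ in atTop, hilbF I m = d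

/-- The degree (length) of the finite scheme with ideal `I` : the eventual value of
its Hilbert function. -/
def schemeDeg (I : Ideal (MvPolynomial (Fin (n+1)) K)) : ℕ :=
  if h : ∃ d : ℕ, ∀ᶠ m : ℕ in atTop, hilbF I m = d then h.choose else 0

/-- The Castelnuovo–Mumford regularity of the finite scheme with ideal `I` : the least
`p ≥ 1` such that the scheme is `(p-1)`-normal (for a finite scheme, `p`-regularity is
equivalent to `(p-1)`-normality). -/
def schemeReg (I : Ideal (MvPolynomial (Fin (n+1)) K)) : ℕ :=
  sInf {p : ℕ | 1 ≤ p ∧ ∀ m : ℕ, p - 1 ≤ m → hilbF I m = schemeDeg I}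

/-- `h¹(ℙ^n, I_Γ(q))` for a finite scheme `Γ` and `q ≥ 0`: the failure of `q`-normality,
`deg Γ - h_Γ(q)`. -/
def h1F (I : Ideal (MvPolynomial (Fin (n+1)) K)) (q : ℕ) : ℕ :=
  schemeDeg I - hilbF I q

/-- `J` is the ideal of a `t`-dimensional linear subspace of `ℙ^n`: it is generated by a
space of linear forms of codimension... i.e. of `K`-dimension `n - t`. -/
def IsLinearSubspace (J : Ideal (MvPolynomial (Fin (n+1)) K)) (t : ℕ) : Prop :=
  ∃ W : Submodule K (MvPolynomial (Fin (n+1)) K),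
    W ≤ MvPolynomial.homogeneousSubmodule (Fin (n+1)) K 1 ∧
    Module.finrank K W + t = n ∧
    J = Ideal.span (W : Set (MvPolynomial (Fin (n+1)) K))

/-- The ideal of the scheme-theoretic intersection (defined by the sum of the ideal
sheaves): the saturation of `I + J`. -/
def interIdeal (I J : Ideal (MvPolynomial (Fin (n+1)) K)) : Ideal (MvPolynomial (Fin (n+1)) K) :=
  saturate (I ⊔ J)

/-- The residual scheme `Γ : V`, where `V` is the hypersurface `{f = 0}`, is defined by
the colon ideal `(I_Γ : f)`. -/
def residualIdeal (I : Ideal (MvPolynomial (Fin (n+1)) K)) (f : MvPolynomial (Fin (n+1)) K) :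
    Ideal (MvPolynomial (Fin (n+1)) K) :=
  Submodule.colon I (Ideal.span {f})

/-- `Γ` admits a `(t+2)`-secant `t`-plane. -/
def HasSecantPlane (I : Ideal (MvPolynomial (Fin (n+1)) K)) (t : ℕ) : Prop :=
  ∃ J : Ideal (MvPolynomial (Fin (n+1)) K),
    IsLinearSubspace J t ∧ t + 2 ≤ schemeDeg (interIdeal I J)

/-- `t(Γ)`: the smallest `t` such that `Γ` admits a `(t+2)`-secant `t`-plane. -/
def tInv (I : Ideal (MvPolynomial (Fin (n+1)) K)) : ℕ :=
  sInf {t : ℕ | HasSecantPlane I t}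

/-- `Γ` is in linearly general position if `t(Γ) = n`. -/
def InLinGenPos (I : Ideal (MvPolynomial (Fin (n+1)) K)) : Prop :=
  tInv I = n

/-- `Γ ⊆ ℙ^n` is nondegenerate: `I(Γ)` contains no nonzero linear form. -/
def NondegenerateScheme (I : Ideal (MvPolynomial (Fin (n+1)) K)) : Prop :=
  Submodule.restrictScalars K I ⊓ MvPolynomial.homogeneousSubmodule (Fin (n+1)) K 1 = ⊥

/-- The (projective) dimension of the linear span `⟨Γ⟩` of the scheme with ideal `I`:
`n` minus the number of independent linear forms in `I`. -/
def spanDim (I : Ideal (MvPolynomial (Fin (n+1)) K)) : ℕ :=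
  n - Module.finrank K
    ↥(Submodule.restrictScalars K I ⊓ MvPolynomial.homogeneousSubmodule (Fin (n+1)) K 1)

/-- `Γ ∩ Λ` is nondegenerate as a subscheme of the `t`-plane `Λ`: it is contained in no
`(t-1)`-dimensional linear subspace of `Λ`. -/
def NondegenerateIn (I Λ : Ideal (MvPolynomial (Fin (n+1)) K)) (t : ℕ) : Prop :=
  ∀ J : Ideal (MvPolynomial (Fin (n+1)) K),
    IsLinearSubspace J (t - 1) → Λ ≤ J → ¬ J ≤ interIdeal I Λ

/-- `Γ ∩ Λ` is in linearly general position as a subscheme of the `t`-plane `Λ`: it has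
no `(s+2)`-secant `s`-plane inside `Λ` for any `s < t`. -/
def InLinGenPosIn (I Λ : Ideal (MvPolynomial (Fin (n+1)) K)) (t : ℕ) : Prop :=
  ∀ s : ℕ, s < t → ∀ J : Ideal (MvPolynomial (Fin (n+1)) K),
    IsLinearSubspace J s → Λ ≤ J → schemeDeg (interIdeal I J) ≤ s + 1

/-- `J` is the (saturated) homogeneous ideal of a rational normal curve of degree `t`
in `ℙ^n` : the curve is the image of `ℙ^1` under a parametrization by a basis-spanning
family of binary forms of degree `t`, and `J` is the vanishing ideal of (the affine cone
over) this image. -/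
def IsRNC (t : ℕ) (J : Ideal (MvPolynomial (Fin (n+1)) K)) : Prop :=
  ∃ p : Fin (n+1) → MvPolynomial (Fin 2) K,
    (∀ i, (p i).IsHomogeneous t) ∧
    Submodule.span K (Set.range p) = MvPolynomial.homogeneousSubmodule (Fin 2) K t ∧
    J = ⨅ x : Fin 2 → K,
      RingHom.ker (MvPolynomial.eval (fun i => MvPolynomial.eval x (p i)) :
        MvPolynomial (Fin (n+1)) K →+* K)

/-- `ρ(Γ)`: the maximal length of the intersection of `Γ` with a rational normal curve
(of degree `n`) in `ℙ^n`. -/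
def rhoInv (I : Ideal (MvPolynomial (Fin (n+1)) K)) : ℕ :=
  sSup {e : ℕ | ∃ J : Ideal (MvPolynomial (Fin (n+1)) K),
    IsRNC n J ∧ e = schemeDeg (interIdeal I J)}

/-- The (saturated homogeneous) vanishing ideal of a point of `ℙ^n`. -/
def pointIdeal (P : Projectivization K (Fin (n+1) → K)) : Ideal (MvPolynomial (Fin (n+1)) K) :=
  ⨅ c : K, RingHom.ker
    (MvPolynomial.eval (c • P.rep) : MvPolynomial (Fin (n+1)) K →+* K)

/-- The vanishing ideal of a finite set of points of `ℙ^n`. -/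
def idealOfFinset (S : Finset (Projectivization K (Fin (n+1) → K))) :
    Ideal (MvPolynomial (Fin (n+1)) K) :=
  ⨅ P ∈ S, pointIdeal P

/-- A finite set of points of `ℙ^n` is in uniform position if every subset `Y` has
Hilbert function `h_Y(ℓ) = min {|Y|, h_Γ(ℓ)}`. -/
def UniformPosition (S : Finset (Projectivization K (Fin (n+1) → K))) : Prop :=
  ∀ Y ⊆ S, ∀ ℓ : ℕ, hilbF (idealOfFinset Y) ℓ = min Y.card (hilbF (idealOfFinset S) ℓ)

end


section EvaluationOfForms

variable {K : Type} [Field K] {n : ℕ} {ι : Type}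

/-- The linear polynomial attached to a linear functional. -/
noncomputable def linForm (φ : Module.Dual K (Fin (n+1) → K)) : MvPolynomial (Fin (n+1)) K :=
  ∑ i, C (φ (Pi.single i 1)) * X i

theorem dual_apply_eq_sum (φ : Module.Dual K (Fin (n+1) → K)) (w : Fin (n+1) → K) :
    φ w = ∑ i, φ (Pi.single i 1) * w i := by
  conv_lhs => rw [pi_eq_sum_univ' w]
  simp [map_sum, mul_comm]

theorem eval_linForm (φ : Module.Dual K (Fin (n+1) → K)) (w : Fin (n+1) → K) :
    eval w (linForm φ) = φ w := by
  rw [dual_apply_eq_sum]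
  simp [linForm]

theorem isHomogeneous_linForm (φ : Module.Dual K (Fin (n+1) → K)) :
    (linForm φ).IsHomogeneous 1 :=
  IsHomogeneous.sum _ _ _ fun i _ => by
    simpa using (isHomogeneous_C _ _).mul (isHomogeneous_X K i)

/-- For any `k` vectors of the family and any further one, some form of degree `m` vanishes at
the former and not at the latter. -/
def Separates (v : ι → Fin (n+1) → K) (k m : ℕ) : Prop :=
  ∀ A : Finset ι, A.card ≤ k → ∀ p ∉ A, ∃ F : MvPolynomial (Fin (n+1)) K,
    F.IsHomogeneous m ∧ (∀ a ∈ A, eval (v a) F = 0) ∧ eval (v p) F ≠ 0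

theorem Separates.mul {v : ι → Fin (n+1) → K} {k k' m m' : ℕ} (h : Separates v k m)
    (h' : Separates v k' m') : Separates v (k + k') (m + m') := by
  intro A hA p hp
  obtain ⟨B, hBA, hB⟩ := Finset.exists_subset_card_eq (min_le_right k A.card)
  obtain ⟨F, hF, hFB, hFp⟩ := h B (hB ▸ min_le_left _ _) p fun hpB => hp (hBA hpB)
  obtain ⟨G, hG, hGB, hGp⟩ := h' (A \ B) (by
    rw [Finset.card_sdiff_of_subset hBA]; omega) p fun hpB => hp (Finset.mem_sdiff.1 hpB).1
  refine ⟨F * G, hF.mul hG, fun a ha => ?_, by simp [hFp, hGp]⟩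
  by_cases haB : a ∈ B
  · simp [hFB a haB]
  · simp [hGB a (Finset.mem_sdiff.2 ⟨ha, haB⟩)]

theorem Separates.pow {v : ι → Fin (n+1) → K} {k : ℕ} (h : Separates v k 1) (m : ℕ) :
    Separates v (k * m) m := by
  induction m with
  | zero =>
    intro A hA p hp
    refine ⟨1, isHomogeneous_one _ _, fun a ha => ?_, by simp⟩
    simp [Finset.card_eq_zero.1 (Nat.le_zero.1 hA)] at ha
  | succ m ih => exact ih.mul h

theorem Separates.comp {v : ι → Fin (n+1) → K} {k m : ℕ} (h : Separates v k m) {κ : Type}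
    (f : κ ↪ ι) : Separates (v ∘ f) k m := by
  intro A hA p hp
  obtain ⟨F, hF, hFA, hFp⟩ := h (A.map f) (by simpa using hA) (f p) (by simpa using hp)
  exact ⟨F, hF, fun a ha => hFA _ (Finset.mem_map_of_mem f ha), hFp⟩

theorem Separates.interpolate [Fintype ι] {v : ι → Fin (n+1) → K} {k m : ℕ}
    (h : Separates v k m) (hk : Fintype.card ι ≤ k + 1) (g : ι → K) :
    ∃ F : MvPolynomial (Fin (n+1)) K, F.IsHomogeneous m ∧ ∀ i, eval (v i) F = g i := by
  have key : ∀ i, ∃ F : MvPolynomial (Fin (n+1)) K, F.IsHomogeneous m ∧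
      (∀ j, j ≠ i → eval (v j) F = 0) ∧ eval (v i) F ≠ 0 := fun i => by
    obtain ⟨F, hF, hF0, hFi⟩ := h (Finset.univ.erase i) (by
      rw [Finset.card_erase_of_mem (Finset.mem_univ i), Finset.card_univ]; omega) i (by simp)
    exact ⟨F, hF, fun j hj => hF0 j (by simp [hj]), hFi⟩
  choose F hF hF0 hFi using key
  refine ⟨∑ i, C (g i / eval (v i) (F i)) * F i, IsHomogeneous.sum _ _ _ fun i _ => by
    simpa using (isHomogeneous_C _ _).mul (hF i), fun i => ?_⟩
  rw [map_sum, Finset.sum_eq_single i]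
  · simp [hFi i]
  · intro j _ hj
    simp [hF0 j i hj.symm]
  · simp

/-- The values at the vectors `v i` of a polynomial. -/
noncomputable def evalMap (v : ι → Fin (n+1) → K) : MvPolynomial (Fin (n+1)) K →ₗ[K] (ι → K) :=
  LinearMap.pi fun i => (aeval (v i)).toLinearMap

theorem evalMap_apply (v : ι → Fin (n+1) → K) (F : MvPolynomial (Fin (n+1)) K) (i : ι) :
    evalMap v F i = eval (v i) F := by
  simp [evalMap, aeval_eq_eval]

/-- The values at the vectors `v i` of the forms of degree `m`. -/
noncomputable def evalSpace (v : ι → Fin (n+1) → K) (m : ℕ) : Submodule K (ι → K) :=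
  (homogeneousSubmodule (Fin (n+1)) K m).map (evalMap v)

theorem mem_evalSpace {v : ι → Fin (n+1) → K} {m : ℕ} {g : ι → K} :
    g ∈ evalSpace v m ↔
      ∃ F : MvPolynomial (Fin (n+1)) K, F.IsHomogeneous m ∧ ∀ i, eval (v i) F = g i := by
  simp [evalSpace, Submodule.mem_map, funext_iff, evalMap_apply]

theorem Separates.evalSpace_eq_top [Fintype ι] {v : ι → Fin (n+1) → K} {k m : ℕ}
    (h : Separates v k m) (hk : Fintype.card ι ≤ k + 1) : evalSpace v m = ⊤ :=
  eq_top_iff.2 fun g _ => mem_evalSpace.2 (h.interpolate hk g)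

theorem finrank_map_eq_of_ker {M N N' : Type} [AddCommGroup M] [Module K M] [AddCommGroup N]
    [Module K N] [AddCommGroup N'] [Module K N'] (H : Submodule K M) (f : M →ₗ[K] N)
    (g : M →ₗ[K] N') (hfg : ∀ x ∈ H, f x = 0 ↔ g x = 0) :
    Module.finrank K (H.map f) = Module.finrank K (H.map g) := by
  have hker : LinearMap.ker (f.domRestrict H) = LinearMap.ker (g.domRestrict H) := by
    ext x
    simpa using hfg x x.2
  rw [← LinearMap.range_domRestrict, ← LinearMap.range_domRestrict]
  exact (((f.domRestrict H).quotKerEquivRange.symm.trans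
    (Submodule.quotEquivOfEq _ _ hker)).trans (g.domRestrict H).quotKerEquivRange).finrank_eq

theorem eval_smul_of_isHomogeneous {σ : Type} {F : MvPolynomial σ K} {m : ℕ}
    (hF : F.IsHomogeneous m) (c : K) (w : σ → K) : eval (c • w) F = c ^ m * eval w F := by
  rw [eval_eq, eval_eq, Finset.mul_sum]
  refine Finset.sum_congr rfl fun d hd => ?_
  have hdeg : ∑ i ∈ d.support, d i = m := by
    rw [← hF (mem_support_iff.1 hd), Finsupp.weight_apply]
    simp [Finsupp.sum]
  simp only [Pi.smul_apply, smul_eq_mul, mul_pow, Finset.prod_mul_distrib, Finset.prod_pow_eq_pow_sum,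
    hdeg]
  ring

theorem mem_idealOfFinset {S : Finset (Projectivization K (Fin (n+1) → K))}
    {F : MvPolynomial (Fin (n+1)) K} :
    F ∈ idealOfFinset S ↔ ∀ P ∈ S, ∀ c : K, eval (c • P.rep) F = 0 := by
  simp [idealOfFinset, pointIdeal, Submodule.mem_iInf, RingHom.mem_ker]

theorem mem_idealOfFinset_of_isHomogeneous {S : Finset (Projectivization K (Fin (n+1) → K))}
    {F : MvPolynomial (Fin (n+1)) K} {m : ℕ} (hF : F.IsHomogeneous m) :
    F ∈ idealOfFinset S ↔ ∀ P ∈ S, eval P.rep F = 0 := by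
  rw [mem_idealOfFinset]
  refine ⟨fun h P hP => by simpa using h P hP 1, fun h P hP c => ?_⟩
  rw [eval_smul_of_isHomogeneous hF, h P hP, mul_zero]

/-- The representatives of the points of a finite set. -/
noncomputable def reps (S : Finset (Projectivization K (Fin (n+1) → K))) :
    {P // P ∈ S} → Fin (n+1) → K :=
  fun P => P.1.rep

theorem hilbF_idealOfFinset (S : Finset (Projectivization K (Fin (n+1) → K))) (m : ℕ) :
    hilbF (idealOfFinset S) m = Module.finrank K (evalSpace (reps S) m) := by
  refine finrank_map_eq_of_ker _ _ _ fun F hF => ?_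
  rw [show (Ideal.Quotient.mkₐ K (idealOfFinset S)).toLinearMap F = 0 ↔ F ∈ idealOfFinset S from
    Ideal.Quotient.eq_zero_iff_mem, mem_idealOfFinset_of_isHomogeneous hF]
  simp [funext_iff, evalMap_apply, reps]

theorem separates_reps_one (S : Finset (Projectivization K (Fin (n+1) → K))) :
    Separates (reps S) 1 1 := by
  intro A hA p hp
  have key : ∃ w : Fin (n+1) → K, reps S p ∉ Submodule.span K {w} ∧
      ∀ a ∈ A, reps S a ∈ Submodule.span K {w} := by
    rcases Finset.eq_empty_or_nonempty A with rfl | ⟨a, ha⟩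
    · exact ⟨0, by simpa [reps] using p.1.rep_nonzero, by simp⟩
    · have hAa : ∀ b ∈ A, b = a := fun b hb => Finset.card_le_one.1 hA b hb a ha
      refine ⟨reps S a, fun h => ?_, fun b hb => hAa b hb ▸ Submodule.mem_span_singleton_self _⟩
      obtain ⟨c, hc⟩ := Submodule.mem_span_singleton.1 h
      apply hp
      have : p.1 = a.1 := by
        rw [← p.1.mk_rep, ← a.1.mk_rep, Projectivization.mk_eq_mk_iff']
        exact ⟨c, hc⟩
      rwa [Subtype.ext this]
  obtain ⟨w, hpw, hw⟩ := key
  obtain ⟨φ, hφp, hφ⟩ := Submodule.exists_le_ker_of_notMem hpw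
  exact ⟨linForm φ, isHomogeneous_linForm φ, fun a ha => by
    rw [eval_linForm]; exact hφ (hw a ha), by rwa [eval_linForm]⟩

theorem schemeDeg_eq_of_forall_ge {I : Ideal (MvPolynomial (Fin (n+1)) K)} {d m₀ : ℕ}
    (h : ∀ m, m₀ ≤ m → hilbF I m = d) : schemeDeg I = d := by
  have hex : ∃ d : ℕ, ∀ᶠ m : ℕ in atTop, hilbF I m = d :=
    ⟨d, eventually_atTop.2 ⟨m₀, h⟩⟩
  rw [schemeDeg, dif_pos hex]
  obtain ⟨m, hm, hm'⟩ := (hex.choose_spec.and (eventually_atTop.2 ⟨m₀, h⟩)).exists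
  exact hm.symm.trans hm'

theorem hilbF_idealOfFinset_of_card_le (S : Finset (Projectivization K (Fin (n+1) → K))) {k m : ℕ}
    (h : Separates (reps S) k m) (hk : S.card ≤ k + 1) : hilbF (idealOfFinset S) m = S.card := by
  rw [hilbF_idealOfFinset, h.evalSpace_eq_top (by simpa using hk), finrank_top,
    Module.finrank_fintype_fun_eq_card, Fintype.card_coe]

theorem schemeDeg_idealOfFinset (S : Finset (Projectivization K (Fin (n+1) → K))) :
    schemeDeg (idealOfFinset S) = S.card :=
  schemeDeg_eq_of_forall_ge (m₀ := S.card) fun m hm =>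
    hilbF_idealOfFinset_of_card_le S ((separates_reps_one S).pow m) (by omega)

end EvaluationOfForms

section LinearlyGeneralPosition

variable {K : Type} [Field K] {n : ℕ} {ι : Type}

theorem le_saturate (I : Ideal (MvPolynomial (Fin (n+1)) K)) : I ≤ saturate I :=
  Ideal.le_colon.trans (le_iSup (fun k : ℕ => Submodule.colon I
    ((irrelevantIdeal K n ^ k : Ideal (MvPolynomial (Fin (n+1)) K)) :
      Set (MvPolynomial (Fin (n+1)) K))) 0)

theorem eval_eq_zero_of_mem_saturate {I : Ideal (MvPolynomial (Fin (n+1)) K)}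
    {w : Fin (n+1) → K} (hw : w ≠ 0) (hI : ∀ F ∈ I, eval w F = 0)
    {F : MvPolynomial (Fin (n+1)) K} (hF : F ∈ saturate I) : eval w F = 0 := by
  obtain ⟨i, hi⟩ := Function.ne_iff.1 hw
  suffices h : saturate I ≤ RingHom.ker (eval w : MvPolynomial (Fin (n+1)) K →+* K) from h hF
  refine iSup_le fun k G hG => ?_
  have hX : (X i : MvPolynomial (Fin (n+1)) K) ^ k ∈ irrelevantIdeal K n ^ k :=
    Ideal.pow_mem_pow (show X i ∈ irrelevantIdeal K n from
      Ideal.subset_span (Set.mem_range_self i)) k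
  have h := hI _ (Submodule.mem_colon.1 hG _ hX)
  rw [smul_eq_mul, map_mul, map_pow, eval_X] at h
  exact (mul_eq_zero.1 h).resolve_right (pow_ne_zero _ hi)

theorem linForm_ne_zero {φ : Module.Dual K (Fin (n+1) → K)} (hφ : φ ≠ 0) : linForm φ ≠ 0 := by
  intro h
  apply hφ
  ext w
  simpa [h] using (eval_linForm φ (Pi.single w 1)).symm

theorem isLinearSubspace_span_linForm (hn : 1 ≤ n) {φ : Module.Dual K (Fin (n+1) → K)}
    (hφ : φ ≠ 0) : IsLinearSubspace (Ideal.span {linForm φ}) (n - 1) := by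
  refine ⟨Submodule.span K {linForm φ}, ?_, ?_, ?_⟩
  · rw [Submodule.span_le, Set.singleton_subset_iff]
    exact isHomogeneous_linForm φ
  · rw [finrank_span_singleton (linForm_ne_zero hφ)]
    omega
  · refine le_antisymm (Ideal.span_mono Submodule.subset_span) (Ideal.span_le.2 fun F hF => ?_)
    obtain ⟨c, rfl⟩ := Submodule.mem_span_singleton.1 hF
    rw [smul_eq_C_mul]
    exact Ideal.mul_mem_left _ _ (Ideal.subset_span rfl)

/-- A hyperplane section of a finite set of points has the expected length. -/
theorem schemeDeg_interIdeal_linForm (S : Finset (Projectivization K (Fin (n+1) → K)))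
    (φ : Module.Dual K (Fin (n+1) → K)) :
    schemeDeg (interIdeal (idealOfFinset S) (Ideal.span {linForm φ})) =
      (S.filter fun P => φ P.rep = 0).card := by
  set T := S.filter fun P => φ P.rep = 0 with hT
  refine schemeDeg_eq_of_forall_ge (m₀ := S.card + 1) fun m hm => ?_
  rw [← hilbF_idealOfFinset_of_card_le T (m := m) ((separates_reps_one T).pow m)
    (by have : T.card ≤ S.card := Finset.card_filter_le _ _; omega)]
  refine finrank_map_eq_of_ker _ _ _ fun F hF => ?_
  rw [mem_homogeneousSubmodule] at hF
  have hmk (I : Ideal (MvPolynomial (Fin (n+1)) K)) :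
      (Ideal.Quotient.mkₐ K I).toLinearMap F = 0 ↔ F ∈ I := Ideal.Quotient.eq_zero_iff_mem
  rw [hmk, hmk, mem_idealOfFinset_of_isHomogeneous hF]
  constructor
  · intro h P hP
    have hPS := Finset.mem_filter.1 hP
    refine eval_eq_zero_of_mem_saturate P.rep_nonzero (fun G hG => ?_) h
    suffices hle : idealOfFinset S ⊔ Ideal.span {linForm φ} ≤
        RingHom.ker (eval P.rep : MvPolynomial (Fin (n+1)) K →+* K) from hle hG
    refine sup_le (fun G hG => ?_) (Ideal.span_le.2 (Set.singleton_subset_iff.2 ?_))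
    · simpa using mem_idealOfFinset.1 hG P hPS.1 1
    · exact (eval_linForm φ _).trans hPS.2
  · intro h
    obtain ⟨G, hG, hGv⟩ := ((separates_reps_one S).pow (m - 1)).interpolate
      (by simp only [Fintype.card_coe]; omega) fun P => eval P.1.rep F / φ P.1.rep
    have hGF : F - G * linForm φ ∈ idealOfFinset S := by
      have hhom : (F - G * linForm φ).IsHomogeneous m := by
        refine hF.sub ?_
        have := hG.mul (isHomogeneous_linForm φ)
        rwa [Nat.sub_add_cancel (by omega)] at this
      rw [mem_idealOfFinset_of_isHomogeneous hhom]
      intro P hP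
      have hGP : eval P.rep G = eval P.rep F / φ P.rep := hGv ⟨P, hP⟩
      rw [map_sub, map_mul, eval_linForm, hGP]
      by_cases h0 : φ P.rep = 0
      · simp [h0, h P (Finset.mem_filter.2 ⟨hP, h0⟩)]
      · field_simp
        ring
    refine le_saturate _ ?_
    rw [← sub_add_cancel F (G * linForm φ)]
    exact add_mem (Ideal.mem_sup_left hGF)
      (Ideal.mem_sup_right (Ideal.mul_mem_left _ _ (Ideal.subset_span rfl)))

theorem InLinGenPos.card_filter_le {S : Finset (Projectivization K (Fin (n+1) → K))}
    (hn : 1 ≤ n) (h : InLinGenPos (idealOfFinset S)) {φ : Module.Dual K (Fin (n+1) → K)}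
    (hφ : φ ≠ 0) : (S.filter fun P => φ P.rep = 0).card ≤ n := by
  by_contra! hlt
  have hsec : HasSecantPlane (idealOfFinset S) (n - 1) :=
    ⟨_, isLinearSubspace_span_linForm hn hφ, by rw [schemeDeg_interIdeal_linForm]; omega⟩
  have : tInv (idealOfFinset S) ≤ n - 1 := Nat.sInf_le hsec
  rw [InLinGenPos] at h
  omega

/-- Every hyperplane contains at most `n` of the vectors `v i`. -/
def HyperplaneBound (v : ι → Fin (n+1) → K) : Prop :=
  ∀ (φ : Module.Dual K (Fin (n+1) → K)) (Z : Finset ι), n + 1 ≤ Z.card →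
    (∀ z ∈ Z, φ (v z) = 0) → φ = 0

theorem InLinGenPos.hyperplaneBound {S : Finset (Projectivization K (Fin (n+1) → K))}
    (hn : 1 ≤ n) (h : InLinGenPos (idealOfFinset S)) : HyperplaneBound (reps S) := by
  intro φ Z hZ hφZ
  by_contra hφ
  have hle := h.card_filter_le hn hφ
  have : (Z.map (Function.Embedding.subtype _)).card ≤ (S.filter fun P => φ P.rep = 0).card := by
    refine Finset.card_le_card fun P hP => ?_
    obtain ⟨z, hz, rfl⟩ := Finset.mem_map.1 hP
    exact Finset.mem_filter.2 ⟨z.2, hφZ z hz⟩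
  rw [Finset.card_map] at this
  omega

theorem HyperplaneBound.exists_dual [Fintype ι] {v : ι → Fin (n+1) → K} (h : HyperplaneBound v)
    (hcard : n + 1 ≤ Fintype.card ι) {A : Finset ι} (hA : A.card ≤ n) {p : ι} (hp : p ∉ A) :
    ∃ φ : Module.Dual K (Fin (n+1) → K), (∀ a ∈ A, φ (v a) = 0) ∧ φ (v p) ≠ 0 := by
  obtain ⟨B, hAB, hBp, hB⟩ := Finset.exists_subsuperset_card_eq
    (show A ⊆ Finset.univ.erase p from fun a ha =>
      Finset.mem_erase.2 ⟨fun hap => hp (hap ▸ ha), Finset.mem_univ a⟩) hA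
    (by rw [Finset.card_erase_of_mem (Finset.mem_univ p), Finset.card_univ]; omega)
  let f : Module.Dual K (Fin (n+1) → K) →ₗ[K] (B → K) :=
    LinearMap.pi fun b => Module.Dual.eval K _ (v b)
  have hf : LinearMap.ker f ≠ ⊥ := LinearMap.ker_ne_bot_of_finrank_lt (by
    rw [Subspace.dual_finrank_eq]
    simp [hB])
  obtain ⟨φ, hφ, hφ0⟩ := Submodule.exists_mem_ne_zero_of_ne_bot hf
  have hφB : ∀ b ∈ B, φ (v b) = 0 := fun b hb => congrFun (LinearMap.mem_ker.1 hφ) ⟨b, hb⟩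
  refine ⟨φ, fun a ha => hφB a (hAB ha), fun hφp => hφ0 (h φ (insert p B) ?_ ?_)⟩
  · rw [Finset.card_insert_of_notMem fun hpB => (Finset.mem_erase.1 (hBp hpB)).1 rfl, hB]
  · intro z hz
    rcases Finset.mem_insert.1 hz with rfl | hz
    exacts [hφp, hφB z hz]

theorem HyperplaneBound.separates [Fintype ι] {v : ι → Fin (n+1) → K} (h : HyperplaneBound v)
    (hcard : n + 1 ≤ Fintype.card ι) : Separates v n 1 := by
  intro A hA p hp
  obtain ⟨φ, hφA, hφp⟩ := h.exists_dual hcard hA hp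
  exact ⟨linForm φ, isHomogeneous_linForm φ, fun a ha => by rw [eval_linForm, hφA a ha],
    by rwa [eval_linForm]⟩

/-- If `n * q + 2` vectors in linearly general position fail to impose independent conditions on
forms of degree `q`, then a form of degree `m ≤ q` vanishing at `n * m + 1` of them vanishes at
all of them. -/
theorem Separates.eval_eq_zero [Fintype ι] {v : ι → Fin (n+1) → K} (h : Separates v n 1)
    {q m : ℕ} (hcard : Fintype.card ι = n * q + 2) (hq : evalSpace v q ≠ ⊤) (hm : m ≤ q)
    {F : MvPolynomial (Fin (n+1)) K} (hF : F.IsHomogeneous m) {Z : Finset ι}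
    (hZ : n * m + 1 ≤ Z.card) (hFZ : ∀ z ∈ Z, eval (v z) F = 0) (p : ι) : eval (v p) F = 0 := by
  obtain ⟨φ, hφ0, hφ⟩ := Submodule.exists_le_ker_of_lt_top _ hq.lt_top
  have hval (g : ι → K) (hg : g ∈ evalSpace v q) (p : ι) (hgp : ∀ i, φ (Pi.single i 1) ≠ 0 →
      i ≠ p → g i = 0) : g p * φ (Pi.single p 1) = 0 := by
    have h0 : φ g = 0 := hφ hg
    rw [pi_eq_sum_univ' g, map_sum, Finset.sum_eq_single p] at h0
    · simpa using h0
    · intro i _ hi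
      by_cases hφi : φ (Pi.single i 1) = 0
      · simp [hφi]
      · simp [hgp i hφi hi]
    · simp
  obtain ⟨j, hj⟩ : ∃ j, φ (Pi.single j 1) ≠ 0 := by
    by_contra! hall
    exact hφ0 (LinearMap.pi_ext' fun i => LinearMap.ext_ring (by simpa using hall i))
  have hne (i : ι) : φ (Pi.single i 1) ≠ 0 := by
    intro hi
    have hij : j ≠ i := fun hij => hj (hij ▸ hi)
    obtain ⟨G, hG, hG0, hGj⟩ := h.pow q ((Finset.univ.erase i).erase j) (by
      rw [Finset.card_erase_of_mem (Finset.mem_erase.2 ⟨hij, Finset.mem_univ j⟩),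
        Finset.card_erase_of_mem (Finset.mem_univ i), Finset.card_univ]
      omega) j (by simp)
    refine mul_ne_zero hGj hj (hval _ (mem_evalSpace.2 ⟨G, hG, fun _ => rfl⟩) j fun k hk hkj => ?_)
    exact hG0 k (Finset.mem_erase.2 ⟨hkj, Finset.mem_erase.2 ⟨fun hki => hk (hki ▸ hi),
      Finset.mem_univ k⟩⟩)
  by_contra hFp
  have hpZ : p ∉ Z := fun hpZ => hFp (hFZ p hpZ)
  obtain ⟨G, hG, hG0, hGp⟩ := h.pow (q - m) ((insert p Z)ᶜ) (by
    have : n * q = n * m + n * (q - m) := by rw [← Nat.mul_add, Nat.add_sub_cancel' hm]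
    rw [Finset.card_compl, Finset.card_insert_of_notMem hpZ]
    omega) p (by simp)
  have hFG : (F * G).IsHomogeneous q := by
    have := hF.mul hG
    rwa [Nat.add_sub_cancel' hm] at this
  have h0 := hval _ (mem_evalSpace.2 ⟨F * G, hFG, fun _ => rfl⟩) p fun i _ hip => by
    by_cases hiZ : i ∈ Z
    · simp [hFZ i hiZ]
    · simp [hG0 i (by simp [hip, hiZ])]
  rw [map_mul] at h0
  exact mul_ne_zero (mul_ne_zero hFp hGp) (hne p) h0

theorem uniformPosition_of_eval_eq_zero {S : Finset (Projectivization K (Fin (n+1) → K))}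
    (hsep : Separates (reps S) n 1)
    (hvan : ∀ (m : ℕ) (F : MvPolynomial (Fin (n+1)) K), F.IsHomogeneous m →
      ∀ Z : Finset {P // P ∈ S}, n * m + 1 ≤ Z.card → (∀ z ∈ Z, eval (reps S z) F = 0) →
      ∀ p, eval (reps S p) F = 0) : UniformPosition S := by
  intro Y hY m
  let f : {P // P ∈ Y} ↪ {P // P ∈ S} := Subtype.impEmbedding _ _ hY
  have hreps : reps Y = reps S ∘ f := rfl
  have hsub (P : {P // P ∈ Y}) : reps S (f P) = reps Y P := rfl
  let r : (({P // P ∈ S}) → K) →ₗ[K] ({P // P ∈ Y} → K) := LinearMap.funLeft K K f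
  have hmap : evalSpace (reps Y) m = (evalSpace (reps S) m).map r := by
    ext g
    simp only [Submodule.mem_map, mem_evalSpace]
    constructor
    · rintro ⟨F, hF, hFg⟩
      exact ⟨_, ⟨F, hF, fun _ => rfl⟩, funext hFg⟩
    · rintro ⟨g', ⟨F, hF, hFg⟩, rfl⟩
      exact ⟨F, hF, fun P => hFg (f P)⟩
  by_cases hcard : Y.card ≤ n * m + 1
  · have hYc := hilbF_idealOfFinset_of_card_le Y (m := m) (hreps ▸ (hsep.pow m).comp f) hcard
    have hle : hilbF (idealOfFinset Y) m ≤ hilbF (idealOfFinset S) m := by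
      rw [hilbF_idealOfFinset, hilbF_idealOfFinset, hmap]
      exact Submodule.finrank_map_le _ _
    omega
  · have heq : hilbF (idealOfFinset Y) m = hilbF (idealOfFinset S) m := by
      rw [hilbF_idealOfFinset, hilbF_idealOfFinset]
      refine finrank_map_eq_of_ker _ _ _ fun F hF => ?_
      simp only [funext_iff, evalMap_apply, Pi.zero_apply]
      refine ⟨fun h => hvan m F hF (Finset.univ.map f) (by simp; omega) ?_,
        fun h P => h (f P)⟩
      intro z hz
      obtain ⟨P, -, rfl⟩ := Finset.mem_map.1 hz
      exact h P
    have hle : hilbF (idealOfFinset Y) m ≤ Y.card := by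
      rw [hilbF_idealOfFinset]
      exact (Submodule.finrank_le _).trans (by simp)
    omega

end LinearlyGeneralPosition

section RationalNormalCurve

variable {K : Type} [Field K] {n : ℕ} {ι : Type}

theorem homogeneousSubmodule_fin_two_le_span (n : ℕ) :
    homogeneousSubmodule (Fin 2) K n ≤ Submodule.span K
      (Set.range fun a : Fin (n+1) => (X 0 ^ (a : ℕ) * X 1 ^ (n - a) : MvPolynomial (Fin 2) K)) := by
  intro F hF
  rw [F.as_sum]
  refine Submodule.sum_mem _ fun d hd => ?_
  have hdeg : d 0 + d 1 = n := by
    rw [← hF (mem_support_iff.1 hd), Finsupp.weight_apply, Finsupp.sum_fintype _ _ (by simp)]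
    simp
  rw [monomial_eq, ← smul_eq_C_mul]
  refine Submodule.smul_mem _ _ (Submodule.subset_span ⟨⟨d 0, by omega⟩, ?_⟩)
  rw [Finsupp.prod_fintype _ _ (by simp), Fin.prod_univ_two]
  simp only [show n - d 0 = d 1 by omega]

theorem finiteDimensional_homogeneousSubmodule_fin_two (n : ℕ) :
    FiniteDimensional K (homogeneousSubmodule (Fin 2) K n) :=
  have := FiniteDimensional.span_of_finite K (Set.finite_range fun a : Fin (n+1) =>
    (X 0 ^ (a : ℕ) * X 1 ^ (n - a) : MvPolynomial (Fin 2) K))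
  Submodule.finiteDimensional_of_le (homogeneousSubmodule_fin_two_le_span n)

theorem finrank_homogeneousSubmodule_fin_two_le (n : ℕ) :
    Module.finrank K (homogeneousSubmodule (Fin 2) K n) ≤ n + 1 :=
  have := FiniteDimensional.span_of_finite K (Set.finite_range fun a : Fin (n+1) =>
    (X 0 ^ (a : ℕ) * X 1 ^ (n - a) : MvPolynomial (Fin 2) K))
  (Submodule.finrank_mono (homogeneousSubmodule_fin_two_le_span n)).trans
    ((finrank_range_le_card _).trans (by simp))

/-- The linear form in two variables with coefficients `a`, `b`. -/
noncomputable def binaryLinForm (a b : K) : MvPolynomial (Fin 2) K := C a * X 0 + C b * X 1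

theorem eval_binaryLinForm (a b : K) (x : Fin 2 → K) :
    eval x (binaryLinForm a b) = a * x 0 + b * x 1 := by
  simp [binaryLinForm]

theorem isHomogeneous_binaryLinForm (a b : K) : (binaryLinForm a b).IsHomogeneous 1 := by
  refine IsHomogeneous.add ?_ ?_
  · simpa using (isHomogeneous_C _ _).mul (isHomogeneous_X K (0 : Fin 2))
  · simpa using (isHomogeneous_C _ _).mul (isHomogeneous_X K (1 : Fin 2))

/-- The product of all but the `i`-th of the binary linear forms with coefficients `a`, `b`. -/
noncomputable def coProd (a b : Fin (n+1) → K) (i : Fin (n+1)) : MvPolynomial (Fin 2) K :=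
  ∏ k ∈ Finset.univ.erase i, binaryLinForm (a k) (b k)

theorem isHomogeneous_coProd (a b : Fin (n+1) → K) (i : Fin (n+1)) :
    (coProd a b i).IsHomogeneous n := by
  have := IsHomogeneous.prod (Finset.univ.erase i) (fun k => binaryLinForm (a k) (b k))
    (fun _ => 1) fun k _ => isHomogeneous_binaryLinForm (a k) (b k)
  simpa [coProd] using this

theorem eval_coProd (a b : Fin (n+1) → K) (i : Fin (n+1)) (x : Fin 2 → K) :
    eval x (coProd a b i) = ∏ k ∈ Finset.univ.erase i, (a k * x 0 + b k * x 1) := by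
  simp [coProd, map_prod, eval_binaryLinForm]

theorem eval_coProd_of_ne (a b : Fin (n+1) → K) {i j : Fin (n+1)} (hij : i ≠ j) :
    eval ![-b j, a j] (coProd a b i) = 0 := by
  rw [eval_coProd]
  exact Finset.prod_eq_zero (Finset.mem_erase.2 ⟨hij.symm, Finset.mem_univ j⟩)
    (by simp; ring)

theorem eval_coProd_self_ne_zero {a b : Fin (n+1) → K}
    (hab : ∀ k l, k ≠ l → a k * b l ≠ a l * b k) (i : Fin (n+1)) :
    eval ![-b i, a i] (coProd a b i) ≠ 0 := by
  rw [eval_coProd, Finset.prod_ne_zero_iff]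
  intro k hk h
  refine hab k i (Finset.ne_of_mem_erase hk) ?_
  simp only [Matrix.cons_val_zero, Matrix.cons_val_one] at h
  linear_combination -h

theorem span_range_coProd {a b : Fin (n+1) → K} (hab : ∀ k l, k ≠ l → a k * b l ≠ a l * b k) :
    Submodule.span K (Set.range (coProd a b)) = homogeneousSubmodule (Fin 2) K n := by
  have hli : LinearIndependent K (coProd a b) := by
    rw [Fintype.linearIndependent_iff]
    intro g hg i
    have h := congrArg (eval ![-b i, a i]) hg
    rw [map_sum, Finset.sum_eq_single i (fun j _ hj => by
      rw [smul_eval, eval_coProd_of_ne a b hj, mul_zero]) (by simp), smul_eval, map_zero] at h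
    exact (mul_eq_zero.1 h).resolve_right (eval_coProd_self_ne_zero hab i)
  have := finiteDimensional_homogeneousSubmodule_fin_two (K := K) n
  refine Submodule.eq_of_le_of_finrank_le (Submodule.span_le.2 ?_) ?_
  · rintro _ ⟨i, rfl⟩
    exact isHomogeneous_coProd a b i
  · rw [finrank_span_eq_card hli, Fintype.card_fin]
    exact finrank_homogeneousSubmodule_fin_two_le n

/-- The rational normal curve through the basis `e`, with Cremona transform the line with
coefficients `a`, `b`. -/
noncomputable def cremonaCurve (e : Module.Basis (Fin (n+1)) K (Fin (n+1) → K))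
    (a b : Fin (n+1) → K) (j : Fin (n+1)) : MvPolynomial (Fin 2) K :=
  ∑ i, C (e i j) * coProd a b i

theorem isHomogeneous_cremonaCurve (e : Module.Basis (Fin (n+1)) K (Fin (n+1) → K))
    (a b : Fin (n+1) → K) (j : Fin (n+1)) : (cremonaCurve e a b j).IsHomogeneous n :=
  IsHomogeneous.sum _ _ _ fun i _ => by
    simpa using (isHomogeneous_C _ _).mul (isHomogeneous_coProd a b i)

theorem span_range_cremonaCurve (e : Module.Basis (Fin (n+1)) K (Fin (n+1) → K))
    {a b : Fin (n+1) → K} (hab : ∀ k l, k ≠ l → a k * b l ≠ a l * b k) :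
    Submodule.span K (Set.range (cremonaCurve e a b)) = homogeneousSubmodule (Fin 2) K n := by
  refine le_antisymm (Submodule.span_le.2 ?_) ?_
  · rintro _ ⟨j, rfl⟩
    exact isHomogeneous_cremonaCurve e a b j
  · rw [← span_range_coProd hab, Submodule.span_le]
    rintro _ ⟨i, rfl⟩
    have hi : coProd a b i = ∑ j, e.coord i (Pi.single j 1) • cremonaCurve e a b j := by
      have hδ (k : Fin (n+1)) :
          ∑ j, e.coord i (Pi.single j 1) * e k j = if k = i then 1 else 0 := by
        rw [← dual_apply_eq_sum (e.coord i) (e k), Module.Basis.coord_apply, e.repr_self,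
          Finsupp.single_apply]
      simp only [cremonaCurve, Finset.smul_sum, smul_eq_C_mul, ← mul_assoc, ← C_mul]
      rw [Finset.sum_comm]
      simp only [← Finset.sum_mul, ← map_sum, hδ]
      simp
    rw [hi]
    exact Submodule.sum_mem _ fun j _ =>
      Submodule.smul_mem _ _ (Submodule.subset_span (Set.mem_range_self j))

theorem eval_cremonaCurve_self (e : Module.Basis (Fin (n+1)) K (Fin (n+1) → K))
    (a b : Fin (n+1) → K) (i j : Fin (n+1)) :
    eval ![-b i, a i] (cremonaCurve e a b j) = eval ![-b i, a i] (coProd a b i) * e i j := by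
  rw [cremonaCurve, map_sum, Finset.sum_eq_single i (fun k _ hk => by
    rw [map_mul, eval_coProd_of_ne a b hk, mul_zero]) (by simp)]
  simp [mul_comm]

theorem eval_cremonaCurve_of_coord_inv (e : Module.Basis (Fin (n+1)) K (Fin (n+1) → K))
    (a b : Fin (n+1) → K) (x : Fin 2 → K) (w : Fin (n+1) → K) (hw : ∀ i, e.coord i w ≠ 0)
    (hx : ∀ i, a i * x 0 + b i * x 1 = (e.coord i w)⁻¹) (j : Fin (n+1)) :
    eval x (cremonaCurve e a b j) = (∏ k, (e.coord k w)⁻¹) * w j := by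
  have hprod (i : Fin (n+1)) :
      eval x (coProd a b i) = (∏ k, (e.coord k w)⁻¹) * e.coord i w := by
    rw [eval_coProd, Finset.prod_congr rfl fun k _ => hx k,
      ← Finset.prod_erase_mul _ _ (Finset.mem_univ i), mul_assoc, inv_mul_cancel₀ (hw i), mul_one]
  have hwj : w j = ∑ i, e.coord i w * e i j := by
    conv_lhs => rw [← e.sum_repr w]
    simp [Finset.sum_apply]
  simp only [cremonaCurve, map_sum, map_mul, eval_C, hprod]
  rw [hwj, Finset.mul_sum]
  exact Finset.sum_congr rfl fun i _ => by ring

theorem HyperplaneBound.exists_basis [Fintype ι] {v : ι → Fin (n+1) → K} (h : HyperplaneBound v)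
    (e : Fin (n+1) ↪ ι) :
    ∃ b : Module.Basis (Fin (n+1)) K (Fin (n+1) → K), ∀ i, b i = v (e i) := by
  have hspan : Submodule.span K (Set.range (v ∘ e)) = ⊤ := by
    by_contra hne
    obtain ⟨φ, hφ, hle⟩ := Submodule.exists_le_ker_of_lt_top _ (lt_top_iff_ne_top.2 hne)
    refine hφ (h φ (Finset.univ.map e) (by simp) fun z hz => ?_)
    obtain ⟨i, -, rfl⟩ := Finset.mem_map.1 hz
    exact hle (Submodule.subset_span ⟨i, rfl⟩)
  exact ⟨basisOfTopLeSpanOfCardEqFinrank (v ∘ e) hspan.ge (by simp), fun i => by simp⟩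

/-- Castelnuovo's lemma: at least `2 * n + 3` vectors in linearly general position such that any
quadric through `2 * n + 1` of them contains all of them lie on a rational normal curve. -/
theorem HyperplaneBound.exists_rationalNormalCurve [Fintype ι] {v : ι → Fin (n+1) → K}
    (h : HyperplaneBound v) (hn : 1 ≤ n) (hcard : 2 * n + 3 ≤ Fintype.card ι)
    (hquad : ∀ F : MvPolynomial (Fin (n+1)) K, F.IsHomogeneous 2 → ∀ Z : Finset ι,
      2 * n + 1 ≤ Z.card → (∀ z ∈ Z, eval (v z) F = 0) → ∀ p, eval (v p) F = 0) :
    ∃ p : Fin (n+1) → MvPolynomial (Fin 2) K, (∀ i, (p i).IsHomogeneous n) ∧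
      Submodule.span K (Set.range p) = homogeneousSubmodule (Fin 2) K n ∧
      ∀ i, ∃ (x : Fin 2 → K) (c : K), c ≠ 0 ∧ ∀ j, eval x (p j) = c * v i j := by
  obtain ⟨e⟩ : Nonempty (Fin (n+1) ↪ ι) :=
    Function.Embedding.nonempty_of_card_le (by rw [Fintype.card_fin]; omega)
  obtain ⟨b, hb⟩ := h.exists_basis e
  set E : Finset ι := Finset.univ.map e with hE
  have hEcard : E.card = n + 1 := by simp [hE]
  have hmemE (i : Fin (n+1)) : e i ∈ E := Finset.mem_map_of_mem e (Finset.mem_univ i)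
  have hbe (i j : Fin (n+1)) : b.coord i (v (e j)) = if j = i then 1 else 0 := by
    rw [← hb, Module.Basis.coord_apply, b.repr_self, Finsupp.single_apply]
  have hbe0 (i : Fin (n+1)) : ∀ z ∈ E.erase (e i), b.coord i (v z) = 0 := by
    intro z hz
    obtain ⟨hzi, hz⟩ := Finset.mem_erase.1 hz
    obtain ⟨j, -, rfl⟩ := Finset.mem_map.1 hz
    rw [hbe, if_neg fun hji : j = i => hzi (hji ▸ rfl)]
  have hcoord0 (i : Fin (n+1)) : b.coord i ≠ 0 := fun h0 => by
    simpa [h0] using hbe i i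
  have hne (i : Fin (n+1)) (p : ι) (hp : p ∉ E) : b.coord i (v p) ≠ 0 := by
    intro h0
    refine hcoord0 i (h _ (insert p (E.erase (e i))) ?_ ?_)
    · rw [Finset.card_insert_of_notMem fun hp' => hp (Finset.mem_of_mem_erase hp'),
        Finset.card_erase_of_mem (hmemE i), hEcard]
      omega
    · intro z hz
      rcases Finset.mem_insert.1 hz with rfl | hz
      exacts [h0, hbe0 i z hz]
  have hdet (k l : Fin (n+1)) (hkl : k ≠ l) (p r : ι) (hp : p ∉ E) (hr : r ∉ E) (hpr : p ≠ r) :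
      b.coord k (v p) * b.coord l (v r) ≠ b.coord l (v p) * b.coord k (v r) := by
    intro h0
    have hφ := h (b.coord l (v p) • b.coord k - b.coord k (v p) • b.coord l)
      (insert p (insert r ((E.erase (e k)).erase (e l)))) ?_ ?_
    · have := LinearMap.congr_fun hφ (v (e k))
      rw [LinearMap.sub_apply, LinearMap.smul_apply, LinearMap.smul_apply, hbe, hbe, if_pos rfl,
        if_neg hkl] at this
      exact hne l p hp (by simpa using this)
    · rw [Finset.card_insert_of_notMem, Finset.card_insert_of_notMem, Finset.card_erase_of_mem,
        Finset.card_erase_of_mem (hmemE k), hEcard]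
      · omega
      · exact Finset.mem_erase.2 ⟨fun hlk => hkl (e.injective hlk).symm, hmemE l⟩
      · simp [hr]
      · simp [hp, hpr]
    · intro z hz
      simp only [LinearMap.sub_apply, LinearMap.smul_apply, smul_eq_mul]
      rcases Finset.mem_insert.1 hz with rfl | hz
      · ring
      rcases Finset.mem_insert.1 hz with rfl | hz
      · linear_combination -h0
      · rw [hbe0 k z (Finset.mem_of_mem_erase hz),
          hbe0 l z (Finset.erase_subset_erase _ (Finset.erase_subset _ _) hz)]
        ring
  obtain ⟨p, r, hp, hr, hpr⟩ : ∃ p r, p ∉ E ∧ r ∉ E ∧ p ≠ r := by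
    have : 1 < (Eᶜ).card := by rw [Finset.card_compl, hEcard]; omega
    obtain ⟨p, hp, r, hr, hpr⟩ := Finset.one_lt_card.1 this
    exact ⟨p, r, Finset.mem_compl.1 hp, Finset.mem_compl.1 hr, hpr⟩
  have h01 : (0 : Fin (n+1)) ≠ 1 := by
    rw [Ne, Fin.ext_iff]
    simp [Nat.mod_eq_of_lt (show 1 < n + 1 by omega)]
  let y (k : Fin (n+1)) (z : ι) : K := (b.coord k (v z))⁻¹
  have hline (k : Fin (n+1)) : ∃ α β : K, ∀ z ∉ E, α * y 0 z + β * y 1 z = y k z := by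
    by_cases hk : k = 0
    · exact ⟨1, 0, fun z _ => by rw [hk]; ring⟩
    have hD := hdet 0 1 h01 p r hp hr hpr
    obtain ⟨α, β, hαp, hαr⟩ : ∃ α β : K,
        α * y 0 p + β * y 1 p = y k p ∧ α * y 0 r + β * y 1 r = y k r := by
      have hD' : y 0 p * y 1 r - y 1 p * y 0 r ≠ 0 := by
        have h1 := hne 0 p hp
        have h2 := hne 0 r hr
        have h3 := hne 1 p hp
        have h4 := hne 1 r hr
        intro h0
        apply hD
        simp only [y] at h0
        field_simp at h0
        linear_combination -h0
      refine ⟨(y k p * y 1 r - y 1 p * y k r) / (y 0 p * y 1 r - y 1 p * y 0 r),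
        (y 0 p * y k r - y k p * y 0 r) / (y 0 p * y 1 r - y 1 p * y 0 r), ?_, ?_⟩ <;>
      · rw [div_mul_eq_mul_div, div_mul_eq_mul_div, ← add_div, div_eq_iff hD']
        ring
    refine ⟨α, β, fun z hz => ?_⟩
    by_cases hzp : z = p
    · rw [hzp, hαp]
    by_cases hzr : z = r
    · rw [hzr, hαr]
    obtain ⟨B, hBsub, hB⟩ : ∃ B ⊆ (insert z (insert p (insert r E)))ᶜ, B.card = n - 1 := by
      refine Finset.exists_subset_card_eq ?_
      have := Finset.card_insert_le z (insert p (insert r E))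
      have := Finset.card_insert_le p (insert r E)
      have := Finset.card_insert_le r E
      rw [Finset.card_compl]
      omega
    have hBmem : ∀ t ∈ B, t ≠ z ∧ t ≠ p ∧ t ≠ r ∧ t ∉ E := fun t ht => by
      simpa using hBsub ht
    have hBins (t : ι) : (insert t B).card ≤ n := (Finset.card_insert_le t B).trans (by omega)
    have hcard' : n + 1 ≤ Fintype.card ι := by omega
    obtain ⟨η, hη, hηz⟩ := h.exists_dual hcard' (hBins (e 0)) (p := z) (by
      rw [Finset.mem_insert, not_or]
      exact ⟨fun hze => hz (hze ▸ hmemE 0), fun hzB => (hBmem z hzB).1 rfl⟩)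
    obtain ⟨u₁, hu₁, hu₁p⟩ := h.exists_dual hcard' (hBins r) (p := p) (by
      rw [Finset.mem_insert, not_or]
      exact ⟨hpr, fun hpB => (hBmem p hpB).2.1 rfl⟩)
    obtain ⟨u₂, hu₂, hu₂r⟩ := h.exists_dual hcard' (hBins p) (p := r) (by
      rw [Finset.mem_insert, not_or]
      exact ⟨hpr.symm, fun hrB => (hBmem r hrB).2.2.1 rfl⟩)
    obtain ⟨u, huB, hup, hur⟩ : ∃ u : Module.Dual K (Fin (n+1) → K), (∀ t ∈ B, u (v t) = 0) ∧
        u (v p) = b.coord 0 (v p) * η (v p) * y 1 p ∧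
        u (v r) = b.coord 0 (v r) * η (v r) * y 1 r := by
      refine ⟨(b.coord 0 (v p) * η (v p) * y 1 p / u₁ (v p)) • u₁ +
        (b.coord 0 (v r) * η (v r) * y 1 r / u₂ (v r)) • u₂, fun t ht => ?_, ?_, ?_⟩
      · simp [hu₁ t (Finset.mem_insert_of_mem ht), hu₂ t (Finset.mem_insert_of_mem ht)]
      · simp [hu₂ p (Finset.mem_insert_self _ _), hu₁p]
      · simp [hu₁ r (Finset.mem_insert_self _ _), hu₂r]
    have hηB : ∀ t ∈ B, η (v t) = 0 := fun t ht => hη t (Finset.mem_insert_of_mem ht)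
    have hη0 : η (v (e 0)) = 0 := hη _ (Finset.mem_insert_self _ _)
    have hquadric (l : Fin (n+1)) (hl : l ≠ 0) (w : Module.Dual K (Fin (n+1) → K))
        (hwB : ∀ t ∈ B, w (v t) = 0)
        (hwp : b.coord 0 (v p) * η (v p) = b.coord l (v p) * w (v p))
        (hwr : b.coord 0 (v r) * η (v r) = b.coord l (v r) * w (v r)) (t : ι) :
        b.coord 0 (v t) * η (v t) = b.coord l (v t) * w (v t) := by
      have heval (s : ι) : eval (v s) (linForm (b.coord 0) * linForm η -
          linForm (b.coord l) * linForm w) =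
          b.coord 0 (v s) * η (v s) - b.coord l (v s) * w (v s) := by
        simp only [map_sub, map_mul, eval_linForm]
      rw [← sub_eq_zero, ← heval]
      refine hquad _ (((isHomogeneous_linForm _).mul (isHomogeneous_linForm _)).sub
        ((isHomogeneous_linForm _).mul (isHomogeneous_linForm _)))
        (insert p (insert r (B ∪ E.erase (e l)))) ?_ ?_ t
      · rw [Finset.card_insert_of_notMem, Finset.card_insert_of_notMem,
          Finset.card_union_of_disjoint, Finset.card_erase_of_mem (hmemE l), hEcard, hB]
        · omega
        · exact Finset.disjoint_left.2 fun s hs hs' =>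
            (hBmem s hs).2.2.2 (Finset.mem_of_mem_erase hs')
        · simp only [Finset.mem_union, Finset.mem_erase, not_or, not_and]
          exact ⟨fun hrB => (hBmem r hrB).2.2.1 rfl, fun _ => hr⟩
        · simp only [Finset.mem_insert, Finset.mem_union, Finset.mem_erase, not_or, not_and]
          exact ⟨hpr, fun hpB => (hBmem p hpB).2.1 rfl, fun _ => hp⟩
      · intro s hs
        rw [heval]
        simp only [Finset.mem_insert, Finset.mem_union] at hs
        rcases hs with rfl | rfl | hs | hs
        · rw [hwp, sub_self]
        · rw [hwr, sub_self]
        · rw [hηB s hs, hwB s hs, mul_zero, mul_zero, sub_self]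
        · rw [hbe0 l s hs]
          by_cases hs0 : s = e 0
          · rw [hs0, hη0]
            ring
          · rw [hbe0 0 s (Finset.mem_erase.2 ⟨hs0, Finset.mem_of_mem_erase hs⟩)]
            ring
    have hxy (l : Fin (n+1)) (s : ι) (hs : s ∉ E) : b.coord l (v s) * y l s = 1 :=
      mul_inv_cancel₀ (hne l s hs)
    have h1 := hquadric 1 h01.symm u huB
      (by rw [hup]; linear_combination (-(b.coord 0 (v p) * η (v p))) * hxy 1 p hp)
      (by rw [hur]; linear_combination (-(b.coord 0 (v r) * η (v r))) * hxy 1 r hr) z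
    have hk' := hquadric k hk (α • η + β • u) (fun t ht => by simp [hηB t ht, huB t ht]) (by
        simp only [LinearMap.add_apply, LinearMap.smul_apply, smul_eq_mul, hup]
        linear_combination (-(b.coord 0 (v p) * η (v p))) * hxy k p hp
          - b.coord k (v p) * b.coord 0 (v p) * η (v p) * hαp
          + α * b.coord k (v p) * η (v p) * hxy 0 p hp) (by
        simp only [LinearMap.add_apply, LinearMap.smul_apply, smul_eq_mul, hur]
        linear_combination (-(b.coord 0 (v r) * η (v r))) * hxy k r hr
          - b.coord k (v r) * b.coord 0 (v r) * η (v r) * hαr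
          + α * b.coord k (v r) * η (v r) * hxy 0 r hr) z
    simp only [LinearMap.add_apply, LinearMap.smul_apply, smul_eq_mul] at hk'
    have hz0 := hne 0 z hz
    have hz1 := hne 1 z hz
    have hzk := hne k z hz
    have hu : u (v z) = b.coord 0 (v z) * η (v z) / b.coord 1 (v z) := by
      rw [h1]
      field_simp
    rw [hu] at hk'
    simp only [y]
    field_simp at hk' ⊢
    linear_combination -hk'
  choose α β hαβ using hline
  have hind (k l : Fin (n+1)) (hkl : k ≠ l) : α k * β l ≠ α l * β k := by
    intro h0
    have hD := hdet k l hkl p r hp hr hpr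
    have hy : y k p * y l r = y l p * y k r := by
      rw [← hαβ k p hp, ← hαβ l p hp, ← hαβ k r hr, ← hαβ l r hr]
      linear_combination (y 0 p * y 1 r - y 1 p * y 0 r) * h0
    apply hD
    have h1 := hne k p hp
    have h2 := hne k r hr
    have h3 := hne l p hp
    have h4 := hne l r hr
    simp only [y] at hy
    field_simp at hy
    linear_combination -hy
  refine ⟨cremonaCurve b α β, isHomogeneous_cremonaCurve b α β, span_range_cremonaCurve b hind,
    fun i => ?_⟩
  by_cases hi : i ∈ E
  · obtain ⟨k, -, rfl⟩ := Finset.mem_map.1 hi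
    exact ⟨_, _, eval_coProd_self_ne_zero hind k, fun j => by
      rw [eval_cremonaCurve_self, hb]⟩
  · refine ⟨![y 0 i, y 1 i], _, ?_, eval_cremonaCurve_of_coord_inv b α β _ (v i)
      (fun k => hne k i hi) fun k => hαβ k i hi⟩
    exact Finset.prod_ne_zero_iff.2 fun k _ => inv_ne_zero (hne k i hi)

/-- The vanishing ideal of a parametrized curve is contained in the ideal of a set of points on
the curve. -/
theorem curveIdeal_le_idealOfFinset [IsAlgClosed K] (hn : 1 ≤ n)
    {S : Finset (Projectivization K (Fin (n+1) → K))} {p : Fin (n+1) → MvPolynomial (Fin 2) K}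
    (hp : ∀ i, (p i).IsHomogeneous n)
    (hS : ∀ P ∈ S, ∃ (x : Fin 2 → K) (c : K), c ≠ 0 ∧ ∀ j, eval x (p j) = c * P.rep j) :
    (⨅ x : Fin 2 → K, RingHom.ker (eval (fun i => eval x (p i)) :
      MvPolynomial (Fin (n+1)) K →+* K)) ≤ idealOfFinset S := by
  intro F hF
  rw [mem_idealOfFinset]
  intro P hP a
  obtain ⟨x, c, hc, hx⟩ := hS P hP
  obtain ⟨z, hz⟩ := IsAlgClosed.exists_pow_nat_eq (a / c) (show 0 < n by omega)
  have hFz : eval (fun i => eval (z • x) (p i)) F = 0 :=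
    RingHom.mem_ker.1 ((Submodule.mem_iInf _).1 hF (z • x))
  rw [show (fun i => eval (z • x) (p i)) = a • P.rep from funext fun i => by
    rw [eval_smul_of_isHomogeneous (hp i), hx, hz, Pi.smul_apply, smul_eq_mul]
    field_simp] at hFz
  exact hFz

end RationalNormalCurve

/-- Corollary 1.5, case `r = 0`. -/
theorem stmt4 (K : Type) [Field K] [IsAlgClosed K] [CharZero K] (n d q : ℕ) (hn : 2 ≤ n)
    (S : Finset (Projectivization K (Fin (n+1) → K)))
    (hcard : S.card = d)
    (hlgp : InLinGenPos (idealOfFinset S))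
    (hd : 4*n^2 + 6*n + 1 ≤ d)
    (hdq : d = n*q + 2)
    (hreg : (schemeReg (idealOfFinset S) : ℤ) = ⌈((d : ℚ) - 1) / (n : ℚ)⌉ + 1) :
    (∃ C : Ideal (MvPolynomial (Fin (n+1)) K), IsRNC n C ∧ C ≤ idealOfFinset S) ∧
      UniformPosition S := by
  have hH : HyperplaneBound (reps S) := hlgp.hyperplaneBound (by omega)
  have hcardι : Fintype.card {P // P ∈ S} = n * q + 2 := by rw [Fintype.card_coe, hcard, hdq]
  have hbig : 2 * n + 3 ≤ Fintype.card {P // P ∈ S} := by rw [Fintype.card_coe]; nlinarith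
  have hsep : Separates (reps S) n 1 := hH.separates (by omega)
  have hceil : ⌈((d : ℚ) - 1) / (n : ℚ)⌉ = q + 1 := by
    have hn0 : (0 : ℚ) < n := by exact_mod_cast (show 0 < n by omega)
    have hn1 : (1 : ℚ) ≤ n := by exact_mod_cast (show 1 ≤ n by omega)
    rw [Int.ceil_eq_iff, hdq, lt_div_iff₀ hn0, div_le_iff₀ hn0]
    push_cast
    constructor <;> nlinarith
  have hfull (m : ℕ) (hm : S.card ≤ n * m + 1) :
      hilbF (idealOfFinset S) m = schemeDeg (idealOfFinset S) := by
    rw [schemeDeg_idealOfFinset, hilbF_idealOfFinset_of_card_le S (hsep.pow m) hm]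
  have hq : evalSpace (reps S) q ≠ ⊤ := by
    intro htop
    have hle : schemeReg (idealOfFinset S) ≤ q + 1 := by
      refine Nat.sInf_le ⟨by omega, fun m hm => ?_⟩
      rcases Nat.lt_or_ge q m with hqm | hqm
      · have : n * (q + 1) ≤ n * m := Nat.mul_le_mul_left n hqm
        exact hfull m (by rw [hcard, hdq]; linarith)
      · obtain rfl : m = q := by omega
        rw [schemeDeg_idealOfFinset, hilbF_idealOfFinset, htop, finrank_top,
          Module.finrank_fintype_fun_eq_card, Fintype.card_coe]
    omega
  have hvan (m : ℕ) (F : MvPolynomial (Fin (n+1)) K) (hF : F.IsHomogeneous m)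
      (Z : Finset {P // P ∈ S}) (hZ : n * m + 1 ≤ Z.card)
      (hFZ : ∀ z ∈ Z, eval (reps S z) F = 0) (P : {P // P ∈ S}) : eval (reps S P) F = 0 := by
    refine hsep.eval_eq_zero hcardι hq ?_ hF hZ hFZ P
    by_contra! hqm
    have h1 : n * (q + 1) ≤ n * m := Nat.mul_le_mul_left n hqm
    have h2 := Z.card_le_univ
    linarith
  obtain ⟨p, hp, hspan, hpts⟩ := hH.exists_rationalNormalCurve (by omega) hbig
    fun F hF Z hZ => hvan 2 F hF Z (by omega)
  refine ⟨⟨_, ⟨p, hp, hspan, rfl⟩, curveIdeal_le_idealOfFinset (by omega) hp fun P hP =>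
    hpts ⟨P, hP⟩⟩, uniformPosition_of_eval_eq_zero hsep hvan⟩
end

section
/- Let Γ ⊂ P^n be a nondegenerate finite subscheme of degree d over an algebraically closed field of characteristic 0 with t(Γ) = t. If ⌈(d−1)/(t + t/(2t+2))⌉ + 2 < reg(Γ) ≤ ⌈(d−n−1)/t⌉ + 2, then there exist a unique t-dimensional linear subspace P^t of P^n and a unique rational normal curve C of degree t in that P^t such that reg(Γ ∩ C) = reg(Γ). -/
open MvPolynomial Filter
open scoped Classical

attribute [local instance] MvPolynomial.gradedAlgebra

section QuotientDimension

variable {K A : Type*} [Field K] [CommRing A] [Algebra K A]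

/-- The dimension of the image of the subspace `W` in the quotient `A ⧸ 𝔞`. -/
noncomputable def quotDim (𝔞 : Ideal A) (W : Submodule K A) : ℕ :=
  Module.finrank K (W.map (Ideal.Quotient.mkₐ K 𝔞).toLinearMap)

theorem quotDim_top (𝔞 : Ideal A) :
    quotDim 𝔞 (⊤ : Submodule K A) = Module.finrank K (A ⧸ 𝔞) := by
  unfold quotDim
  rw [Submodule.map_top, LinearMap.range_eq_top.2 (Ideal.Quotient.mkₐ_surjective K 𝔞)]
  exact finrank_top K _

theorem quotDim_add_finrank_inf [FiniteDimensional K A] (𝔞 : Ideal A) (W : Submodule K A) :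
    quotDim 𝔞 W + Module.finrank K ↥(W ⊓ 𝔞.restrictScalars K) = Module.finrank K W := by
  have h := LinearMap.finrank_range_add_finrank_ker
    ((Ideal.Quotient.mkₐ K 𝔞).toLinearMap.domRestrict W)
  rw [LinearMap.range_domRestrict, LinearMap.ker_domRestrict] at h
  have e : LinearMap.ker (Ideal.Quotient.mkₐ K 𝔞).toLinearMap = 𝔞.restrictScalars K := by
    ext x
    simp [Ideal.Quotient.eq_zero_iff_mem]
  rw [e] at h
  have h2 : Module.finrank K ↥((𝔞.restrictScalars K).comap W.subtype)
      = Module.finrank K ↥(W ⊓ 𝔞.restrictScalars K) := by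
    rw [← Submodule.finrank_map_subtype_eq, Submodule.map_comap_subtype]
  unfold quotDim
  rw [← h2]
  exact h

variable [FiniteDimensional K A]

theorem finrank_quotient_add_finrank_ideal (𝔞 : Ideal A) :
    Module.finrank K (A ⧸ 𝔞) + Module.finrank K ↥(𝔞.restrictScalars K) = Module.finrank K A := by
  have h := quotDim_add_finrank_inf 𝔞 (⊤ : Submodule K A)
  rwa [quotDim_top, top_inf_eq, finrank_top] at h

theorem quotDim_mono (𝔞 : Ideal A) {W W' : Submodule K A} (h : W ≤ W') :
    quotDim 𝔞 W ≤ quotDim 𝔞 W' :=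
  Submodule.finrank_mono (Submodule.map_mono h)

theorem quotDim_le (𝔞 : Ideal A) (W : Submodule K A) :
    quotDim 𝔞 W ≤ Module.finrank K (A ⧸ 𝔞) :=
  quotDim_top (K := K) 𝔞 ▸ quotDim_mono 𝔞 le_top

theorem quotDim_anti {𝔞 𝔟 : Ideal A} (h : 𝔞 ≤ 𝔟) (W : Submodule K A) :
    quotDim 𝔟 W ≤ quotDim 𝔞 W := by
  have h1 := quotDim_add_finrank_inf 𝔞 W
  have h2 := quotDim_add_finrank_inf 𝔟 W
  have h3 : Module.finrank K ↥(W ⊓ 𝔞.restrictScalars K) ≤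
      Module.finrank K ↥(W ⊓ 𝔟.restrictScalars K) :=
    Submodule.finrank_mono (inf_le_inf_left W h)
  omega

theorem finrank_quotient_anti {𝔞 𝔟 : Ideal A} (h : 𝔞 ≤ 𝔟) :
    Module.finrank K (A ⧸ 𝔟) ≤ Module.finrank K (A ⧸ 𝔞) := by
  simpa only [quotDim_top] using quotDim_anti h (⊤ : Submodule K A)

theorem exists_mem_of_quotDim_lt (𝔞 𝔟 : Ideal A) {W : Submodule K A}
    (hlt : quotDim 𝔟 W < quotDim 𝔞 W) : ∃ f ∈ W, f ∈ 𝔟 ∧ f ∉ 𝔞 := by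
  by_contra! hc
  have h1 := quotDim_add_finrank_inf 𝔞 W
  have h2 := quotDim_add_finrank_inf 𝔟 W
  have h3 : Module.finrank K ↥(W ⊓ 𝔟.restrictScalars K) ≤
      Module.finrank K ↥(W ⊓ 𝔞.restrictScalars K) :=
    Submodule.finrank_mono fun x hx => ⟨hx.1, hc x hx.1 hx.2⟩
  omega

theorem finrank_quotient_lt_of_lt {𝔞 𝔟 : Ideal A} (h : 𝔞 < 𝔟) :
    Module.finrank K (A ⧸ 𝔟) < Module.finrank K (A ⧸ 𝔞) := by
  have h1 := finrank_quotient_add_finrank_ideal (K := K) 𝔞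
  have h2 := finrank_quotient_add_finrank_ideal (K := K) 𝔟
  have h3 : Module.finrank K ↥(𝔞.restrictScalars K) < Module.finrank K ↥(𝔟.restrictScalars K) :=
    Submodule.finrank_lt_finrank_of_lt h
  omega

theorem quotDim_eq_finrank_iff (𝔞 : Ideal A) (W : Submodule K A) :
    quotDim 𝔞 W = Module.finrank K (A ⧸ 𝔞) ↔ W ⊔ 𝔞.restrictScalars K = ⊤ := by
  have h1 := quotDim_add_finrank_inf 𝔞 W
  have h2 := finrank_quotient_add_finrank_ideal (K := K) 𝔞
  have h3 := Submodule.finrank_sup_add_finrank_inf_eq W (𝔞.restrictScalars K)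
  constructor
  · intro h
    apply Submodule.eq_top_of_finrank_eq
    omega
  · intro h
    rw [h, finrank_top] at h3
    omega

/-- Multiplication by `f` identifies `A ⧸ (𝔞 : f)` with the kernel of
`A ⧸ 𝔞 → A ⧸ (𝔞 + (f))`. -/
theorem quotDim_residual_add_le (𝔞 : Ideal A) (f : A) {W W' : Submodule K A}
    (hW : ∀ x ∈ W', f * x ∈ W) :
    quotDim (Submodule.colon 𝔞 {f}) W' + quotDim (𝔞 ⊔ Ideal.span {f}) W ≤ quotDim 𝔞 W := by
  have h1 := quotDim_add_finrank_inf (Submodule.colon 𝔞 {f}) W'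
  have h2 := quotDim_add_finrank_inf (𝔞 ⊔ Ideal.span {f}) W
  have h3 := quotDim_add_finrank_inf 𝔞 W
  set X := (W ⊓ 𝔞.restrictScalars K) with hX
  set Y := W'.map (LinearMap.mulLeft K f) with hY
  have h4 := LinearMap.finrank_range_add_finrank_ker
    ((LinearMap.mulLeft K f).domRestrict W')
  have h5 := LinearMap.finrank_range_add_finrank_ker
    ((LinearMap.mulLeft K f).domRestrict (W' ⊓ (Submodule.colon 𝔞 {f}).restrictScalars K))
  rw [LinearMap.range_domRestrict, LinearMap.ker_domRestrict,
    ← Submodule.finrank_map_subtype_eq, Submodule.map_comap_subtype] at h4 h5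
  have h6 : Module.finrank K ↥(X ⊔ Y) ≤
      Module.finrank K ↥(W ⊓ (𝔞 ⊔ Ideal.span {f}).restrictScalars K) := by
    apply Submodule.finrank_mono
    rw [sup_le_iff]
    constructor
    · exact inf_le_inf_left W (show 𝔞 ≤ 𝔞 ⊔ Ideal.span {f} from le_sup_left)
    · rintro _ ⟨x, hx, rfl⟩
      refine ⟨hW x hx, ?_⟩
      exact (le_sup_right : Ideal.span {f} ≤ 𝔞 ⊔ Ideal.span {f})
        (Ideal.mul_mem_right _ _ (Ideal.mem_span_singleton_self f))
  have h7 := Submodule.finrank_sup_add_finrank_inf_eq X Y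
  have h8 : X ⊓ Y ≤ (W' ⊓ (Submodule.colon 𝔞 {f}).restrictScalars K).map
      (LinearMap.mulLeft K f) := by
    rintro _ ⟨hx, y, hy, rfl⟩
    refine ⟨y, ⟨hy, ?_⟩, rfl⟩
    have : f * y ∈ 𝔞 := hx.2
    simpa [Submodule.mem_colon_singleton, mul_comm] using this
  have h9 := Submodule.finrank_mono h8
  have h10 : W' ⊓ (Submodule.colon 𝔞 {f}).restrictScalars K ⊓
      LinearMap.ker (LinearMap.mulLeft K f) = W' ⊓ LinearMap.ker (LinearMap.mulLeft K f) := by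
    apply le_antisymm
    · exact inf_le_inf_right _ inf_le_left
    · intro x hx
      refine ⟨⟨hx.1, ?_⟩, hx.2⟩
      have : f * x = 0 := hx.2
      simp [Submodule.mem_colon_singleton, mul_comm x f, this]
  rw [h10] at h5
  rw [← hY] at h4
  omega

theorem finrank_residual_add (𝔞 : Ideal A) (f : A) :
    Module.finrank K (A ⧸ Submodule.colon 𝔞 {f}) + Module.finrank K (A ⧸ (𝔞 ⊔ Ideal.span {f})) =
      Module.finrank K (A ⧸ 𝔞) := by
  apply le_antisymm
  · simpa only [quotDim_top] using
      quotDim_residual_add_le 𝔞 f (W := (⊤ : Submodule K A)) (W' := ⊤) (fun _ _ => trivial)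
  · have h1 := finrank_quotient_add_finrank_ideal (K := K) (Submodule.colon 𝔞 {f})
    have h2 := finrank_quotient_add_finrank_ideal (K := K) (𝔞 ⊔ Ideal.span {f})
    have h3 := finrank_quotient_add_finrank_ideal (K := K) 𝔞
    have h4 := LinearMap.finrank_range_add_finrank_ker (LinearMap.mulLeft K f)
    have h5 := LinearMap.finrank_range_add_finrank_ker
      ((LinearMap.mulLeft K f).domRestrict ((Submodule.colon 𝔞 {f}).restrictScalars K))
    rw [LinearMap.range_domRestrict, LinearMap.ker_domRestrict,
      ← Submodule.finrank_map_subtype_eq, Submodule.map_comap_subtype] at h5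
    set Y := LinearMap.range (LinearMap.mulLeft K f) with hY
    have h6 : (𝔞 ⊔ Ideal.span {f}).restrictScalars K ≤ 𝔞.restrictScalars K ⊔ Y := by
      intro x hx
      obtain ⟨a, ha, b, hb, rfl⟩ := Submodule.mem_sup.1 (show x ∈ 𝔞 ⊔ Ideal.span {f} from hx)
      obtain ⟨c, rfl⟩ := Ideal.mem_span_singleton.1 hb
      exact Submodule.add_mem_sup ha ⟨c, rfl⟩
    have h7 := Submodule.finrank_sup_add_finrank_inf_eq (𝔞.restrictScalars K) Y
    have h8 : ((Submodule.colon 𝔞 {f}).restrictScalars K).map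
        (LinearMap.mulLeft K f) ≤ 𝔞.restrictScalars K ⊓ Y := by
      rintro _ ⟨x, hx, rfl⟩
      refine ⟨?_, ⟨x, rfl⟩⟩
      have : x * f ∈ 𝔞 := by simpa [Submodule.mem_colon_singleton] using hx
      simpa [mul_comm] using this
    have h9 := Submodule.finrank_mono h8
    have h10 := Submodule.finrank_mono h6
    have h11 : Module.finrank K
      ↥((Submodule.colon 𝔞 {f}).restrictScalars K ⊓ LinearMap.ker (LinearMap.mulLeft K f))
      ≤ Module.finrank K ↥(LinearMap.ker (LinearMap.mulLeft K f)) :=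
      Submodule.finrank_mono inf_le_right
    omega

/-- Over an algebraically closed field a finite algebra has quotients of every smaller length. -/
theorem exists_ideal_finrank_quotient_eq [IsAlgClosed K] (𝔞 : Ideal A) {m : ℕ}
    (hm : m ≤ Module.finrank K (A ⧸ 𝔞)) :
    ∃ 𝔟 : Ideal A, 𝔞 ≤ 𝔟 ∧ Module.finrank K (A ⧸ 𝔟) = m := by
  obtain ⟨𝔟, ⟨h𝔟, hm𝔟⟩, hmin⟩ := WellFounded.has_min
    (measure fun 𝔟 : Ideal A => Module.finrank K (A ⧸ 𝔟)).wf
    {𝔟 : Ideal A | 𝔞 ≤ 𝔟 ∧ m ≤ Module.finrank K (A ⧸ 𝔟)} ⟨𝔞, le_rfl, hm⟩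
  refine ⟨𝔟, h𝔟, le_antisymm ?_ hm𝔟⟩
  by_contra! hlt
  have hne : Nontrivial (A ⧸ 𝔟) := Module.nontrivial_of_finrank_pos (R := K) (by omega)
  have : IsNoetherianRing A := isNoetherian_of_tower K inferInstance
  obtain ⟨P, hP⟩ := associatedPrimes.nonempty A (A ⧸ 𝔟)
  obtain ⟨hPp, x, hx⟩ := isAssociatedPrime_iff.1 hP
  obtain ⟨f, rfl⟩ := Ideal.Quotient.mk_surjective x
  have hP2 : P = Submodule.colon 𝔟 {f} := by
    rw [hx]
    ext r
    simp only [Submodule.mem_colon_singleton, Submodule.mem_bot]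
    rw [← Ideal.Quotient.eq_zero_iff_mem]
    rfl
  have h1 : Module.finrank K (A ⧸ P) = 1 := by
    have hb := IsAlgClosed.algebraMap_bijective_of_isIntegral (k := K) (K := A ⧸ P)
    have e := LinearEquiv.ofBijective (Algebra.linearMap K (A ⧸ P)) hb
    rw [← e.finrank_eq, Module.finrank_self]
  have h2 := finrank_residual_add (K := K) 𝔟 f
  rw [← hP2, h1] at h2
  refine hmin (𝔟 ⊔ Ideal.span {f}) ⟨le_trans h𝔟 le_sup_left, by omega⟩ ?_
  change Module.finrank K (A ⧸ (𝔟 ⊔ Ideal.span {f})) < Module.finrank K (A ⧸ 𝔟)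
  omega

end QuotientDimension

section Filtration

variable {K A : Type*} [Field K] [CommRing A] [Algebra K A] [FiniteDimensional K A]

/-- Subspaces `U i` of `A`, to be thought of as the images of the forms of degree `i` on a finite
scheme with coordinate ring `A`, such that every subscheme of length at most `t + 1` imposes
independent conditions on `U 1`. -/
structure GeneralPosition (U : ℕ → Submodule K A) (t : ℕ) : Prop where
  one_mem : ∀ i, 1 ∈ U i
  mul_mem : ∀ {i j x y}, x ∈ U i → y ∈ U j → x * y ∈ U (i + j)
  finrank_le : ∀ 𝔞 : Ideal A, quotDim 𝔞 (U 1) ≤ t →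
    Module.finrank K (A ⧸ 𝔞) ≤ quotDim 𝔞 (U 1)

namespace GeneralPosition

variable {U : ℕ → Submodule K A} {t : ℕ} (hU : GeneralPosition U t)
include hU

omit [FiniteDimensional K A] in
theorem mono {i j : ℕ} (h : i ≤ j) : U i ≤ U j := by
  obtain ⟨k, rfl⟩ := Nat.exists_eq_add_of_le h
  intro x hx
  simpa using hU.mul_mem hx (hU.one_mem k)

theorem quotDim_residual_add_le {i m : ℕ} (𝔞 : Ideal A) {f : A} (hf : f ∈ U m) :
    quotDim (Submodule.colon 𝔞 {f}) (U i) + quotDim (𝔞 ⊔ Ideal.span {f}) (U (i + m)) ≤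
      quotDim 𝔞 (U (i + m)) :=
  _root_.quotDim_residual_add_le 𝔞 f fun x hx => by
    rw [mul_comm]
    exact hU.mul_mem hx hf

omit [FiniteDimensional K A] in
theorem min_le_quotDim_one (𝔞 : Ideal A) :
    min (Module.finrank K (A ⧸ 𝔞)) (t + 1) ≤ quotDim 𝔞 (U 1) := by
  by_cases h : quotDim 𝔞 (U 1) ≤ t
  · have := hU.finrank_le 𝔞 h
    omega
  · omega

theorem one_le_quotDim {𝔞 : Ideal A} (h : 1 ≤ Module.finrank K (A ⧸ 𝔞)) (i : ℕ) :
    1 ≤ quotDim 𝔞 (U i) := by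
  have hne : Nontrivial (A ⧸ 𝔞) := Module.nontrivial_of_finrank_pos (R := K) (by omega)
  rw [quotDim, Submodule.one_le_finrank_iff]
  intro hbot
  have : (Ideal.Quotient.mkₐ K 𝔞) 1 ∈ (U i).map (Ideal.Quotient.mkₐ K 𝔞).toLinearMap :=
    ⟨1, hU.one_mem i, rfl⟩
  rw [hbot, Submodule.mem_bot, map_one] at this
  exact one_ne_zero this

variable [IsAlgClosed K]

/-- A finite scheme in general position has at least the Hilbert function of points on a rational
normal curve. -/
theorem min_le_quotDim (i : ℕ) (𝔞 : Ideal A) :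
    min (Module.finrank K (A ⧸ 𝔞)) (i * t + 1) ≤ quotDim 𝔞 (U i) := by
  induction i generalizing 𝔞 with
  | zero =>
    by_cases h : 1 ≤ Module.finrank K (A ⧸ 𝔞)
    · have := hU.one_le_quotDim h 0
      omega
    · omega
  | succ i ih =>
    induction hN : Module.finrank K (A ⧸ 𝔞) using Nat.strong_induction_on generalizing 𝔞 with
    | _ N ihN =>
    have h1 := hU.min_le_quotDim_one 𝔞
    have h1' := quotDim_mono 𝔞 (hU.mono (show 1 ≤ i + 1 by omega))
    by_cases hNt : N ≤ t + 1
    · omega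
    obtain ⟨𝔷, h𝔷, h𝔷t⟩ := exists_ideal_finrank_quotient_eq (K := K) 𝔞 (m := t) (by omega)
    have h2 := quotDim_le 𝔷 (U 1)
    obtain ⟨f, hfU, hf𝔷, hf𝔞⟩ := exists_mem_of_quotDim_lt 𝔞 𝔷 (W := U 1) (by omega)
    have h3 := finrank_residual_add (K := K) 𝔞 f
    have h4 := hU.quotDim_residual_add_le (i := i) 𝔞 hfU
    have h5 : Module.finrank K (A ⧸ 𝔷) ≤ Module.finrank K (A ⧸ (𝔞 ⊔ Ideal.span {f})) :=
      finrank_quotient_anti (sup_le h𝔷 ((Ideal.span_singleton_le_iff_mem _).2 hf𝔷))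
    have h6 : Module.finrank K (A ⧸ (𝔞 ⊔ Ideal.span {f})) < Module.finrank K (A ⧸ 𝔞) :=
      finrank_quotient_lt_of_lt (by simpa using hf𝔞)
    have h7 := ih (Submodule.colon 𝔞 {f})
    have h8 := ihN _ (hN ▸ h6) _ rfl
    have h9 : (i + 1) * t = i * t + t := by ring
    omega

/-- If no large subscheme satisfies the equality `dim U 2 = 2 t + 1` of Castelnuovo's lemma, then
the Hilbert function grows at rate `t + 1 / 2`. -/
theorem min_le_two_mul_quotDim (ht : 1 ≤ t) (i : ℕ) (𝔞 : Ideal A)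
    (hE : ∀ 𝔟, 𝔞 ≤ 𝔟 → quotDim 𝔟 (U 2) ≤ 2 * t + 1 → Module.finrank K (A ⧸ 𝔟) ≤ i * t + 1) :
    min (2 * Module.finrank K (A ⧸ 𝔞)) (i * (2 * t + 1)) ≤ 2 * quotDim 𝔞 (U i) := by
  induction i using Nat.strong_induction_on generalizing 𝔞 with
  | _ i ih =>
  induction hN : Module.finrank K (A ⧸ 𝔞) using Nat.strong_induction_on generalizing 𝔞 with
  | _ N ihN =>
  have h0 := hU.min_le_quotDim i 𝔞
  by_cases hNt : N ≤ i * t + 1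
  · omega
  match i, ih, hE, ihN, h0, hNt with
  | 0, _, _, _, _, _ => simp
  | 1, _, _, _, h0, hNt => omega
  | i + 2, ih, hE, ihN, h0, hNt =>
    have h1 : 2 * t + 2 ≤ quotDim 𝔞 (U 2) := by
      by_contra! h
      have := hE 𝔞 le_rfl (by omega)
      omega
    have h1' := quotDim_le 𝔞 (U 2)
    obtain ⟨𝔟, ⟨h𝔟, h𝔟2⟩, hmin⟩ := WellFounded.has_min
      (measure fun 𝔟 : Ideal A => N - Module.finrank K (A ⧸ 𝔟)).wf
      {𝔟 : Ideal A | 𝔞 ≤ 𝔟 ∧ quotDim 𝔟 (U 2) ≤ 2 * t + 1} (by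
        obtain ⟨𝔷, h𝔷, h𝔷t⟩ := exists_ideal_finrank_quotient_eq (K := K) 𝔞 (m := 0) (by omega)
        exact ⟨𝔷, h𝔷, (quotDim_le _ _).trans (by omega)⟩)
    have hmax : ∀ 𝔠, 𝔞 ≤ 𝔠 → quotDim 𝔠 (U 2) ≤ 2 * t + 1 →
        Module.finrank K (A ⧸ 𝔠) ≤ Module.finrank K (A ⧸ 𝔟) := by
      intro 𝔠 h𝔠 h𝔠2
      have h := hmin 𝔠 ⟨h𝔠, h𝔠2⟩
      change ¬ (N - Module.finrank K (A ⧸ 𝔠) < N - Module.finrank K (A ⧸ 𝔟)) at h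
      have h2 := finrank_quotient_anti (K := K) h𝔟
      have h3 := finrank_quotient_anti (K := K) h𝔠
      omega
    have hb : 2 * t + 1 ≤ Module.finrank K (A ⧸ 𝔟) := by
      obtain ⟨𝔷, h𝔷, h𝔷t⟩ := exists_ideal_finrank_quotient_eq (K := K) 𝔞 (m := 2 * t + 1)
        (by omega)
      exact h𝔷t ▸ hmax 𝔷 h𝔷 (h𝔷t ▸ quotDim_le _ _)
    obtain ⟨f, hfU, hf𝔟, hf𝔞⟩ := exists_mem_of_quotDim_lt 𝔞 𝔟 (W := U 2) (by omega)
    have h3 := finrank_residual_add (K := K) 𝔞 f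
    have h4 := hU.quotDim_residual_add_le (i := i) 𝔞 hfU
    have h5 : Module.finrank K (A ⧸ 𝔟) ≤ Module.finrank K (A ⧸ (𝔞 ⊔ Ideal.span {f})) :=
      finrank_quotient_anti (sup_le h𝔟 ((Ideal.span_singleton_le_iff_mem _).2 hf𝔟))
    have h6 : Module.finrank K (A ⧸ (𝔞 ⊔ Ideal.span {f})) < Module.finrank K (A ⧸ 𝔞) :=
      finrank_quotient_lt_of_lt (by simpa using hf𝔞)
    have h7 := ihN _ (hN ▸ h6) (𝔞 ⊔ Ideal.span {f})
      (fun 𝔠 h𝔠 => hE 𝔠 (le_sup_left.trans h𝔠)) rfl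
    have hR : 𝔞 ≤ Submodule.colon 𝔞 {f} := Ideal.le_colon
    by_cases hc : ∀ 𝔠, Submodule.colon 𝔞 {f} ≤ 𝔠 → quotDim 𝔠 (U 2) ≤ 2 * t + 1 →
        Module.finrank K (A ⧸ 𝔠) ≤ i * t + 1
    · have h8 := ih i (by omega) (Submodule.colon 𝔞 {f}) hc
      have h9 : (i + 2) * (2 * t + 1) = i * (2 * t + 1) + 2 * (2 * t + 1) := by ring
      omega
    · push Not at hc
      obtain ⟨𝔠, h𝔠, h𝔠2, h𝔠i⟩ := hc
      have h8 := hmax 𝔠 (hR.trans h𝔠) h𝔠2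
      have h9 := finrank_quotient_anti (K := K) h𝔠
      have h10 := hU.min_le_quotDim i (Submodule.colon 𝔞 {f})
      have h11 : (i + 2) * (2 * t + 1) ≤ 2 * (i * t + 1) + 2 * max (i * t + 2) (2 * t + 1) := by
        rcases Nat.lt_or_ge i 2 with hi | hi
        · interval_cases i <;> omega
        · obtain ⟨i, rfl⟩ := Nat.exists_eq_add_of_le hi
          have : (2 + i) * t + 2 ≤ max ((2 + i) * t + 2) (2 * t + 1) := le_max_left _ _
          nlinarith
      omega

end GeneralPosition

end Filtration

section Gorenstein

variable {K A : Type*} [Field K] [CommRing A] [Algebra K A]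

/-- The largest ideal contained in the kernel of the functional `φ`. -/
def functionalAnnihilator (φ : A →ₗ[K] K) : Ideal A where
  carrier := {a | ∀ b, φ (a * b) = 0}
  zero_mem' := by simp
  add_mem' := by
    intro a b ha hb c
    rw [add_mul, map_add, ha, hb, add_zero]
  smul_mem' := by
    intro c a ha b
    rw [smul_eq_mul, mul_comm c a, mul_assoc]
    exact ha _

theorem mem_functionalAnnihilator {φ : A →ₗ[K] K} {a : A} :
    a ∈ functionalAnnihilator φ ↔ ∀ b, φ (a * b) = 0 := Iff.rfl

theorem colon_functionalAnnihilator (φ : A →ₗ[K] K) (f : A) :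
    Submodule.colon (functionalAnnihilator φ) {f} =
      functionalAnnihilator (φ ∘ₗ LinearMap.mulLeft K f) := by
  ext a
  simp only [Submodule.mem_colon_singleton, smul_eq_mul, mem_functionalAnnihilator,
    LinearMap.comp_apply, LinearMap.mulLeft_apply]
  refine forall_congr' fun b => ?_
  rw [mul_comm a f, mul_assoc]

theorem quotDim_add_quotDim_le [FiniteDimensional K A] (φ : A →ₗ[K] K) {W W' : Submodule K A}
    (h : ∀ x ∈ W, ∀ y ∈ W', φ (x * y) = 0) :
    quotDim (functionalAnnihilator φ) W + quotDim (functionalAnnihilator φ) W' ≤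
      Module.finrank K (A ⧸ functionalAnnihilator φ) := by
  set 𝔫 := functionalAnnihilator φ with h𝔫
  let B : A →ₗ[K] Module.Dual K A := (LinearMap.mul K A).compr₂ φ
  have hB : ∀ a b, B a b = φ (a * b) := fun a b => rfl
  have hker : LinearMap.ker B = 𝔫.restrictScalars K := by
    ext a
    simp only [LinearMap.mem_ker, LinearMap.ext_iff, hB, LinearMap.zero_apply]
    rfl
  have h1 := LinearMap.finrank_range_add_finrank_ker (B.domRestrict W)
  rw [LinearMap.range_domRestrict, LinearMap.ker_domRestrict,
    ← Submodule.finrank_map_subtype_eq, Submodule.map_comap_subtype, hker] at h1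
  have h2 : W.map B ≤ (W' ⊔ 𝔫.restrictScalars K).dualAnnihilator := by
    rintro _ ⟨x, hx, rfl⟩
    rw [Submodule.mem_dualAnnihilator]
    intro w hw
    obtain ⟨y, hy, z, hz, rfl⟩ := Submodule.mem_sup.1 hw
    rw [hB, mul_add, map_add, h x hx y hy, mul_comm x z, zero_add]
    exact hz x
  have h3 := Submodule.finrank_mono h2
  have h4 := Subspace.finrank_add_finrank_dualAnnihilator_eq (W' ⊔ 𝔫.restrictScalars K)
  have h5 := Submodule.finrank_sup_add_finrank_inf_eq W' (𝔫.restrictScalars K)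
  have h6 := quotDim_add_finrank_inf 𝔫 W
  have h7 := quotDim_add_finrank_inf 𝔫 W'
  have h8 := finrank_quotient_add_finrank_ideal (K := K) 𝔫
  omega

end Gorenstein

section MapFinrank

variable {K M N N' : Type*} [Field K] [AddCommGroup M] [Module K M] [AddCommGroup N] [Module K N]
  [AddCommGroup N'] [Module K N']

theorem finrank_map_eq_of_ker_s5 {W : Submodule K M} {g : M →ₗ[K] N} {g' : M →ₗ[K] N'}
    (h : ∀ x ∈ W, g x = 0 ↔ g' x = 0) :
    Module.finrank K (W.map g) = Module.finrank K (W.map g') := by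
  rw [← LinearMap.range_domRestrict, ← LinearMap.range_domRestrict,
    ← (g.domRestrict W).quotKerEquivRange.finrank_eq,
    ← (g'.domRestrict W).quotKerEquivRange.finrank_eq]
  refine (Submodule.quotEquivOfEq _ _ ?_).finrank_eq
  ext x
  simpa using h x x.2

theorem finrank_map_add_finrank_inf_ker (W : Submodule K M) [FiniteDimensional K W]
    (g : M →ₗ[K] N) :
    Module.finrank K (W.map g) + Module.finrank K ↥(W ⊓ LinearMap.ker g) = Module.finrank K W := by
  have h := LinearMap.finrank_range_add_finrank_ker (g.domRestrict W)
  rwa [LinearMap.range_domRestrict, LinearMap.ker_domRestrict,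
    ← Submodule.finrank_map_subtype_eq, Submodule.map_comap_subtype] at h

/-- Over an algebraically closed field, a pencil of maps stabilising a nonzero subspace has a
kernel. -/
theorem exists_pencil_eigenvector [IsAlgClosed K] [FiniteDimensional K M] {X : Submodule K M}
    (hX : X ≠ ⊥) (F G : M →ₗ[K] N) (hF : ∀ x ∈ X, F x = 0 → x = 0) (hGF : X.map G ≤ X.map F) :
    ∃ x ∈ X, x ≠ 0 ∧ ∃ c : K, G x = c • F x := by
  have hinj : Function.Injective (F.domRestrict X) := by
    rw [injective_iff_map_eq_zero]
    intro x hx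
    exact Subtype.ext (hF x x.2 hx)
  let e := LinearEquiv.ofInjective _ hinj
  have hmem : ∀ x : X, G.domRestrict X x ∈ LinearMap.range (F.domRestrict X) := fun x => by
    rw [LinearMap.range_domRestrict]
    exact hGF ⟨x, x.2, rfl⟩
  let T : X →ₗ[K] X := e.symm.toLinearMap ∘ₗ (G.domRestrict X).codRestrict _ hmem
  have hT : ∀ x, F (T x) = G x := fun x => by
    have h : e (T x) = (G.domRestrict X).codRestrict _ hmem x := e.apply_symm_apply _
    exact congrArg Subtype.val h
  have : Nontrivial X := Submodule.nontrivial_iff_ne_bot.2 hX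
  obtain ⟨c, hc⟩ := Module.End.exists_eigenvalue T
  obtain ⟨x, hx⟩ := hc.exists_hasEigenvector
  refine ⟨x, x.2, fun h => hx.2 (Subtype.ext h), c, ?_⟩
  rw [← hT, hx.apply_eq_smul]
  simp

end MapFinrank

section Castelnuovo

variable {K A : Type*} [Field K] [CommRing A] [Algebra K A] [FiniteDimensional K A]
  {U : ℕ → Submodule K A} {t : ℕ}

omit [FiniteDimensional K A] in
theorem finrank_quotient_bot :
    Module.finrank K (A ⧸ (⊥ : Ideal A)) = Module.finrank K A :=
  (AlgEquiv.quotientBot K A).toLinearEquiv.finrank_eq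

theorem GeneralPosition.eq_zero_of_mul_eq_zero [IsAlgClosed K] (hU : GeneralPosition U t)
    (h1 : Module.finrank K (U 1) = t + 1) (h2 : Module.finrank K (U 2) ≤ 2 * t + 1)
    (hA : 3 * t + 1 ≤ Module.finrank K A) {f c : A} (hf : f ∈ U 1) (hf0 : f ≠ 0)
    (hc : c ∈ U 2) (hfc : f * c = 0) : c = 0 := by
  have h3 := finrank_residual_add (K := K) (⊥ : Ideal A) f
  have h4 := quotDim_add_finrank_inf (⊥ ⊔ Ideal.span {f}) (U 1)
  have h5 : 1 ≤ Module.finrank K ↥(U 1 ⊓ (⊥ ⊔ Ideal.span {f}).restrictScalars K) := by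
    rw [Submodule.one_le_finrank_iff, Submodule.ne_bot_iff]
    exact ⟨f, ⟨hf, by simp⟩, hf0⟩
  have h6 := hU.finrank_le (⊥ ⊔ Ideal.span {f}) (by omega)
  have h7 := finrank_quotient_bot (K := K) (A := A)
  have h9 := hU.min_le_quotDim 2 (Submodule.colon (⊥ : Ideal A) {f})
  have h10 := quotDim_add_finrank_inf (Submodule.colon (⊥ : Ideal A) {f}) (U 2)
  have h11 : U 2 ⊓ (Submodule.colon (⊥ : Ideal A) {f}).restrictScalars K = ⊥ := by
    rw [← Submodule.finrank_eq_zero (R := K)]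
    omega
  have h12 : c ∈ U 2 ⊓ (Submodule.colon (⊥ : Ideal A) {f}).restrictScalars K :=
    ⟨hc, by simpa [Submodule.mem_colon_singleton, mul_comm] using hfc⟩
  rwa [h11, Submodule.mem_bot] at h12

/-- **Castelnuovo's lemma**: a scheme of length at least `3 t + 1` in general position in `ℙ^t`
imposing only `2 t + 1` conditions on quadrics lies on a rational normal curve. -/
theorem GeneralPosition.exists_basis [IsAlgClosed K] (hU : GeneralPosition U t) (ht : 1 ≤ t)
    (h1 : Module.finrank K (U 1) = t + 1) (h2 : Module.finrank K (U 2) ≤ 2 * t + 1)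
    (hA : 3 * t + 1 ≤ Module.finrank K A) :
    ∃ b : ℕ → A, Submodule.span K (b '' Set.Iio (t + 1)) = U 1 ∧
      ∀ i < t, ∀ j < t, b i * b (j + 1) = b (i + 1) * b j := by
  have hreg := fun {f c : A} => hU.eq_zero_of_mul_eq_zero h1 h2 hA (f := f) (c := c)
  have hU12 := hU.mono (show 1 ≤ 2 by omega)
  have hbot : t - 1 ≤ Module.finrank K (A ⧸ (⊥ : Ideal A)) := by
    have h7 := finrank_quotient_bot (K := K) (A := A)
    omega
  obtain ⟨𝔷, -, h𝔷⟩ := exists_ideal_finrank_quotient_eq (K := K) _ hbot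
  have h3 := quotDim_add_finrank_inf 𝔷 (U 1)
  have h4 := quotDim_le 𝔷 (U 1)
  have h5 := quotDim_add_finrank_inf 𝔷 (U 2)
  have h6 := hU.min_le_quotDim 2 𝔷
  obtain ⟨f, hf, hf0⟩ := Submodule.exists_mem_ne_zero_of_ne_bot
    (p := U 1 ⊓ 𝔷.restrictScalars K) (by
      rw [← Submodule.one_le_finrank_iff (R := K)]
      omega)
  obtain ⟨g, hg, hgf⟩ : ∃ g ∈ U 1 ⊓ 𝔷.restrictScalars K, g ∉ Submodule.span K {f} := by
    by_contra! hc
    have h := Submodule.finrank_mono (R := K) (show _ ≤ Submodule.span K {f} from hc)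
    rw [finrank_span_singleton hf0] at h
    omega
  have hg0 : g ≠ 0 := fun h => hgf (h ▸ Submodule.zero_mem _)
  let F := LinearMap.mulLeft K f
  let G := LinearMap.mulLeft K g
  have hinj : ∀ {e : A} {X : Submodule K A}, X ≤ U 1 → e ∈ U 1 → e ≠ 0 →
      Module.finrank K (X.map (LinearMap.mulLeft K e)) = Module.finrank K X := by
    intro e X hX he he0
    have h := finrank_map_add_finrank_inf_ker X (LinearMap.mulLeft K e)
    have h' : X ⊓ LinearMap.ker (LinearMap.mulLeft K e) = ⊥ := by
      rw [Submodule.eq_bot_iff]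
      exact fun x hx => hreg he he0 (hU12 (hX hx.1)) hx.2
    rwa [h', finrank_bot, add_zero] at h
  obtain ⟨D, hD0, hDs⟩ : ∃ D : ℕ → Submodule K A, D 0 = U 1 ∧
      ∀ j, D (j + 1) = U 1 ⊓ ((D j).map F).comap G :=
    ⟨fun j => Nat.rec (U 1) (fun _ X => U 1 ⊓ (X.map F).comap G) j, rfl, fun _ => rfl⟩
  have hDU : ∀ j, D j ≤ U 1 := by
    rintro (_ | j)
    · exact hD0.le
    · exact (hDs j).le.trans inf_le_left
  have hDdim : ∀ j, t + 1 ≤ Module.finrank K (D j) + j := by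
    intro j
    induction j with
    | zero => rw [hD0, h1, add_zero]
    | succ j ih =>
      have h7 : (D (j + 1)).map G = (U 1).map G ⊓ (D j).map F := by
        rw [hDs]
        ext x
        simp only [Submodule.mem_map, Submodule.mem_inf, Submodule.mem_comap]
        constructor
        · rintro ⟨y, ⟨hy, hy'⟩, rfl⟩
          exact ⟨⟨y, hy, rfl⟩, hy'⟩
        · rintro ⟨⟨y, hy, rfl⟩, hy'⟩
          exact ⟨y, ⟨hy, hy'⟩, rfl⟩
      have h8 := hinj (hDU (j + 1)) hg.1 hg0
      have h9 := hinj (hDU j) hf.1 hf0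
      have h10 := hinj (le_refl (U 1)) hg.1 hg0
      have h11 := Submodule.finrank_sup_add_finrank_inf_eq ((U 1).map G) ((D j).map F)
      have h12 : (U 1).map G ⊔ (D j).map F ≤ U 2 ⊓ 𝔷.restrictScalars K := by
        refine sup_le ?_ ?_
        · rintro _ ⟨x, hx, rfl⟩
          exact ⟨hU.mul_mem hg.1 hx, Ideal.mul_mem_right _ _ hg.2⟩
        · rintro _ ⟨x, hx, rfl⟩
          exact ⟨hU.mul_mem hf.1 (hDU j hx), Ideal.mul_mem_right _ _ hf.2⟩
      have h13 := Submodule.finrank_mono h12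
      rw [← h7] at h11
      change Module.finrank K ((D (j + 1)).map G) = _ at h8
      change Module.finrank K ((D j).map F) = _ at h9
      change Module.finrank K ((U 1).map G) = _ at h10
      omega
  have hseq : ∀ j, ∀ x ∈ D j, ∃ b : ℕ → A, b 0 = x ∧ (∀ i ≤ j, b i ∈ U 1) ∧
      ∀ i < j, f * b (i + 1) = g * b i := by
    intro j
    induction j with
    | zero => exact fun x hx => ⟨fun _ => x, rfl, fun _ _ => hDU 0 hx, fun _ h => absurd h (by omega)⟩
    | succ j ih =>
      intro x hxD
      rw [hDs] at hxD
      obtain ⟨hx, y, hy, hxy⟩ := hxD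
      obtain ⟨b, rfl, hb1, hb2⟩ := ih y hy
      refine ⟨fun i => Nat.casesOn i x b, rfl, ?_, ?_⟩
      · rintro (_ | i) hi
        · exact hx
        · exact hb1 i (by omega)
      · rintro (_ | i) hi
        · exact hxy
        · exact hb2 i (by omega)
  obtain ⟨x, hx, hx0⟩ := Submodule.exists_mem_ne_zero_of_ne_bot (p := D t) (by
    rw [← Submodule.one_le_finrank_iff (R := K)]
    have := hDdim t
    omega)
  obtain ⟨b, rfl, hb1, hb2⟩ := hseq t x hx
  have hspan : ∀ r ≤ t + 1, Submodule.span K (b '' Set.Iio r) ≤ U 1 := by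
    rintro r hr
    rw [Submodule.span_le]
    rintro _ ⟨i, hi, rfl⟩
    exact hb1 i (by have : i < r := hi; omega)
  have hfin : ∀ r ≤ t + 1, r ≤ Module.finrank K (Submodule.span K (b '' Set.Iio r)) := by
    intro r
    induction r with
    | zero => simp
    | succ r ih =>
      intro hr
      have hlt : Submodule.span K (b '' Set.Iio r) < Submodule.span K (b '' Set.Iio (r + 1)) := by
        refine lt_of_le_of_ne (Submodule.span_mono (Set.image_mono (Set.Iio_subset_Iio
          (by omega)))) fun heq => ?_
        have hr0 : r ≠ 0 := by
          rintro rfl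
          have : b 0 ∈ Submodule.span K (b '' Set.Iio (0 + 1)) :=
            Submodule.subset_span ⟨0, by simp, rfl⟩
          rw [← heq] at this
          simp at this
          exact hx0 this
        have hne : Submodule.span K (b '' Set.Iio r) ≠ ⊥ := by
          rw [Submodule.ne_bot_iff]
          exact ⟨b 0, Submodule.subset_span ⟨0, Nat.pos_of_ne_zero hr0, rfl⟩, hx0⟩
        obtain ⟨y, hy, hy0, c, hyc⟩ := exists_pencil_eigenvector hne F G
          (fun z hz hFz => hreg hf.1 hf0 (hU12 (hspan r (by omega) hz)) hFz) (by
            rw [Submodule.map_span, Submodule.span_le]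
            rintro _ ⟨_, ⟨i, hi, rfl⟩, rfl⟩
            have hi' : i < r := hi
            refine ⟨b (i + 1), ?_, hb2 i (by omega)⟩
            rw [heq]
            exact Submodule.subset_span ⟨i + 1, by simpa using hi', rfl⟩)
        refine hy0 (hreg (f := g - c • f) (sub_mem hg.1 (Submodule.smul_mem _ _ hf.1)) ?_
          (hU12 (hspan r (by omega) hy)) ?_)
        · intro h
          exact hgf (Submodule.mem_span_singleton.2 ⟨c, (sub_eq_zero.1 h).symm⟩)
        · have hyc' : g * y = c • (f * y) := hyc
          rw [sub_mul, hyc', smul_mul_assoc, sub_self]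
      have := Submodule.finrank_lt_finrank_of_lt hlt
      have := ih (by omega)
      omega
  refine ⟨b, Submodule.eq_of_le_of_finrank_le (hspan _ le_rfl) (by rw [h1]; exact hfin _ le_rfl),
    fun i hi j hj => ?_⟩
  refine sub_eq_zero.1 (hreg hf.1 hf0 (sub_mem (hU.mul_mem (hb1 i (by omega))
    (hb1 (j + 1) (by omega))) (hU.mul_mem (hb1 (i + 1) (by omega)) (hb1 j (by omega)))) ?_)
  linear_combination b i * hb2 j hj - b j * hb2 i hi

end Castelnuovo

section Existence

variable {K A : Type*} [Field K] [CommRing A] [Algebra K A]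
  {U : ℕ → Submodule K A} {t : ℕ}

theorem quotDim_map (𝔫 : Ideal A) (𝔟 : Ideal (A ⧸ 𝔫)) (W : Submodule K A) :
    quotDim 𝔟 (W.map (Ideal.Quotient.mkₐ K 𝔫).toLinearMap) =
      quotDim (𝔟.comap (Ideal.Quotient.mk 𝔫)) W := by
  unfold quotDim
  rw [← Submodule.map_comp]
  refine finrank_map_eq_of_ker_s5 fun x _ => ?_
  simp [Ideal.Quotient.eq_zero_iff_mem]

theorem finrank_quotient_comap (𝔫 : Ideal A) (𝔟 : Ideal (A ⧸ 𝔫)) :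
    Module.finrank K (A ⧸ 𝔟.comap (Ideal.Quotient.mk 𝔫)) = Module.finrank K ((A ⧸ 𝔫) ⧸ 𝔟) := by
  rw [← quotDim_top (K := K), ← quotDim_top (K := K), ← quotDim_map, Submodule.map_top,
    LinearMap.range_eq_top.2 (Ideal.Quotient.mkₐ_surjective K 𝔫)]

theorem GeneralPosition.map_quotient (hU : GeneralPosition U t) (𝔫 : Ideal A) :
    GeneralPosition (fun i => (U i).map (Ideal.Quotient.mkₐ K 𝔫).toLinearMap) t where
  one_mem i := ⟨1, hU.one_mem i, map_one (Ideal.Quotient.mkₐ K 𝔫)⟩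
  mul_mem := by
    rintro i j _ _ ⟨x, hx, rfl⟩ ⟨y, hy, rfl⟩
    exact ⟨x * y, hU.mul_mem hx hy, map_mul (Ideal.Quotient.mkₐ K 𝔫) x y⟩
  finrank_le 𝔟 h := by
    rw [quotDim_map] at h ⊢
    rw [← finrank_quotient_comap]
    exact hU.finrank_le _ h

variable [FiniteDimensional K A]

theorem quotDim_functionalAnnihilator_lt {φ : A →ₗ[K] K} (hφ : φ ≠ 0) {W : Submodule K A}
    (hW : W ≤ LinearMap.ker φ) :
    quotDim (functionalAnnihilator φ) W < Module.finrank K (A ⧸ functionalAnnihilator φ) := by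
  refine lt_of_le_of_ne (quotDim_le _ _) fun h => hφ ?_
  rw [quotDim_eq_finrank_iff] at h
  rw [← LinearMap.ker_eq_top, eq_top_iff, ← h]
  refine sup_le hW fun x hx => ?_
  simpa using mem_functionalAnnihilator.1 hx 1

omit [FiniteDimensional K A] in
theorem mulLeft_comp_ne_zero {φ : A →ₗ[K] K} {f : A} (hf : f ∉ functionalAnnihilator φ) :
    φ ∘ₗ LinearMap.mulLeft K f ≠ 0 := by
  rw [mem_functionalAnnihilator] at hf
  push Not at hf
  obtain ⟨b, hb⟩ := hf
  exact fun h => hb (LinearMap.congr_fun h b)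

namespace GeneralPosition

variable [IsAlgClosed K] (hU : GeneralPosition U t)
include hU

/-- A subscheme not imposing independent conditions in degree `m` has length at least
`m t + 2`. -/
theorem le_finrank_of_ne_top {m : ℕ} {𝔞 : Ideal A} (h : U m ⊔ 𝔞.restrictScalars K ≠ ⊤) :
    m * t + 2 ≤ Module.finrank K (A ⧸ 𝔞) := by
  have h1 := hU.min_le_quotDim m 𝔞
  have h2 := lt_of_le_of_ne (quotDim_le 𝔞 (U m)) fun h' => h ((quotDim_eq_finrank_iff _ _).1 h')
  omega

theorem le_finrank_functionalAnnihilator {φ : A →ₗ[K] K} (hφ : φ ≠ 0) {m : ℕ}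
    (hm : U m ≤ LinearMap.ker φ) :
    m * t + 2 ≤ Module.finrank K (A ⧸ functionalAnnihilator φ) := by
  have h1 := hU.min_le_quotDim m (functionalAnnihilator φ)
  have h2 := quotDim_functionalAnnihilator_lt hφ hm
  omega

theorem le_finrank_residual {φ : A →ₗ[K] K} {m i : ℕ} (hm : U (m + i) ≤ LinearMap.ker φ) {f : A}
    (hf : f ∈ U i) (hfφ : f ∉ functionalAnnihilator φ) :
    m * t + 2 ≤ Module.finrank K (A ⧸ Submodule.colon (functionalAnnihilator φ) {f}) := by
  rw [colon_functionalAnnihilator]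
  refine hU.le_finrank_functionalAnnihilator (mulLeft_comp_ne_zero hfφ) fun x hx => ?_
  have := hm (hU.mul_mem hx hf)
  rwa [mul_comm] at this

/-- A functional on a scheme of small length killing the forms of high degree is supported on a
subscheme imposing few conditions on quadrics. -/
theorem quotDim_two_le (ht : 1 ≤ t) {κ : ℕ} {φ : A →ₗ[K] K} (hφ : φ ≠ 0)
    (hκ : U (κ + 1) ≤ LinearMap.ker φ)
    (hD : (Module.finrank K (A ⧸ functionalAnnihilator φ) - 1) * (2 * t + 2) ≤
      κ * t * (2 * t + 3)) :
    quotDim (functionalAnnihilator φ) (U 2) ≤ 2 * t + 1 := by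
  have h1 := hU.le_finrank_functionalAnnihilator hφ hκ
  obtain ⟨D, hDe⟩ : ∃ D, Module.finrank K (A ⧸ functionalAnnihilator φ) = D + 1 :=
    ⟨_, (Nat.sub_add_cancel (by omega)).symm⟩
  rw [hDe] at hD h1
  rw [Nat.add_sub_cancel] at hD
  set P := κ * t with hP
  have h2 : (κ + 1) * t = P + t := by ring
  have h3 : (t + 1) * (2 * t + 2) ≤ P := by nlinarith
  have h4 : 1 ≤ κ := by
    by_contra! h
    obtain rfl : κ = 0 := by omega
    nlinarith
  obtain ⟨m, rfl⟩ := Nat.exists_eq_add_of_le' h4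
  by_contra! hlt
  have hE : ∀ i, m + 1 ≤ 2 * i → ∀ 𝔟, functionalAnnihilator φ ≤ 𝔟 →
      quotDim 𝔟 (U 2) ≤ 2 * t + 1 → Module.finrank K (A ⧸ 𝔟) ≤ i * t + 1 := by
    intro i hi 𝔟 h𝔟 h𝔟2
    obtain ⟨f, hfU, hf𝔟, hf𝔞⟩ := exists_mem_of_quotDim_lt (functionalAnnihilator φ) 𝔟 (W := U 2) (by omega)
    have h5 := finrank_residual_add (K := K) (functionalAnnihilator φ) f
    have h6 : Module.finrank K (A ⧸ 𝔟) ≤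
        Module.finrank K (A ⧸ (functionalAnnihilator φ ⊔ Ideal.span {f})) :=
      finrank_quotient_anti (sup_le h𝔟 ((Ideal.span_singleton_le_iff_mem _).2 hf𝔟))
    have h7 := hU.le_finrank_residual (m := m) (i := 2) hκ hfU hf𝔞
    have h8 : P = m * t + t := by rw [hP]; ring
    have h9 : P ≤ 2 * (i * t) := by nlinarith
    by_contra! h10
    have h11 : i * t + 1 + P + 1 ≤ D + t := by omega
    have h12 : (i * t + 1 + P + 1) * (2 * t + 2) ≤ (D + t) * (2 * t + 2) :=
      Nat.mul_le_mul_right _ h11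
    have h13 : P * (2 * t + 2) ≤ 2 * (i * t) * (2 * t + 2) := Nat.mul_le_mul_right _ h9
    nlinarith
  have hlt' : ∀ i, i ≤ m + 1 + 1 → quotDim (functionalAnnihilator φ) (U i) ≤ D := by
    intro i hi
    have := quotDim_functionalAnnihilator_lt hφ ((hU.mono hi).trans hκ)
    omega
  have hlow : ∀ i, m + 1 ≤ 2 * i → i ≤ m + 1 + 1 →
      i * (2 * t + 1) ≤ 2 * quotDim (functionalAnnihilator φ) (U i) := by
    intro i hi hi'
    have h5 := hU.min_le_two_mul_quotDim ht i _ (hE i hi)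
    have h6 := hlt' i hi'
    omega
  obtain ⟨i, j, hij, hi, hj⟩ : ∃ i j, i + j = m + 1 + 1 ∧ m + 1 ≤ 2 * i ∧ m + 1 ≤ 2 * j :=
    ⟨(m + 2) / 2, m + 2 - (m + 2) / 2, by omega, by omega, by omega⟩
  have h5 := hlow i hi (by omega)
  have h6 := hlow j hj (by omega)
  have h7 := quotDim_add_quotDim_le φ (W := U i) (W' := U j) fun x hx y hy =>
    hκ (hij ▸ hU.mul_mem hx hy)
  have h8 : (m + 1 + 1) * (2 * t + 1) = i * (2 * t + 1) + j * (2 * t + 1) := by rw [← hij]; ring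
  have h9 : (m + 1 + 1) * (2 * t + 1) ≤ 2 * (D + 1) := by omega
  have h10 : (m + 1 + 1) * (2 * t + 1) * (t + 1) ≤ 2 * (D + 1) * (t + 1) :=
    Nat.mul_le_mul_right _ h9
  rw [hP] at hD
  nlinarith

theorem quotDim_one_eq (ht : 1 ≤ t) {κ : ℕ} (hκ0 : 1 ≤ κ) {φ : A →ₗ[K] K} (hφ : φ ≠ 0)
    (hκ : U (κ + 1) ≤ LinearMap.ker φ)
    (h2 : quotDim (functionalAnnihilator φ) (U 2) ≤ 2 * t + 1) :
    quotDim (functionalAnnihilator φ) (U 1) = t + 1 := by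
  have h1 := hU.le_finrank_functionalAnnihilator hφ hκ
  have h3 := hU.min_le_quotDim_one (functionalAnnihilator φ)
  have h4 : t ≤ κ * t := by nlinarith
  have h5 : (κ + 1) * t = κ * t + t := by ring
  by_contra! hne
  obtain ⟨𝔷, h𝔷, h𝔷t⟩ := exists_ideal_finrank_quotient_eq (K := K) (functionalAnnihilator φ)
    (m := t + 1) (by omega)
  have h6 := quotDim_le 𝔷 (U 1)
  obtain ⟨f, hfU, hf𝔷, hf𝔞⟩ := exists_mem_of_quotDim_lt (functionalAnnihilator φ) 𝔷 (W := U 1) (by omega)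
  have h7 := hU.le_finrank_residual hκ hfU hf𝔞
  have h8 := hU.quotDim_residual_add_le (i := 1) (functionalAnnihilator φ) hfU
  have h9 := hU.min_le_quotDim_one (Submodule.colon (functionalAnnihilator φ) {f})
  have h10 := hU.min_le_quotDim (1 + 1) (functionalAnnihilator φ ⊔ Ideal.span {f})
  have h11 : Module.finrank K (A ⧸ 𝔷) ≤
      Module.finrank K (A ⧸ (functionalAnnihilator φ ⊔ Ideal.span {f})) :=
    finrank_quotient_anti (sup_le h𝔷 ((Ideal.span_singleton_le_iff_mem _).2 hf𝔷))
  change quotDim (functionalAnnihilator φ) (U (1 + 1)) ≤ 2 * t + 1 at h2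
  omega

/-- A scheme of small length in general position not imposing independent conditions in high
degree contains a subscheme with the same property on a rational normal curve. -/
theorem exists_castelnuovo_quotient (ht : 1 ≤ t) {κ : ℕ} (hκ : U (κ + 1) ≠ ⊤)
    (hd : (Module.finrank K A - 1) * (2 * t + 2) ≤ κ * t * (2 * t + 3)) :
    ∃ 𝔫 : Ideal A, U (κ + 1) ⊔ 𝔫.restrictScalars K ≠ ⊤ ∧ quotDim 𝔫 (U 1) = t + 1 ∧
      ∃ b : ℕ → A ⧸ 𝔫,
      Submodule.span K (b '' Set.Iio (t + 1)) = (U 1).map (Ideal.Quotient.mkₐ K 𝔫).toLinearMap ∧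
      ∀ i < t, ∀ j < t, b i * b (j + 1) = b (i + 1) * b j := by
  obtain ⟨φ, hφ, hφκ⟩ := Submodule.exists_le_ker_of_lt_top (U (κ + 1)) hκ.lt_top
  have h1 := hU.le_finrank_functionalAnnihilator hφ hφκ
  have h2 := finrank_quotient_add_finrank_ideal (K := K) (functionalAnnihilator φ)
  have h3 : (Module.finrank K (A ⧸ functionalAnnihilator φ) - 1) * (2 * t + 2) ≤
      κ * t * (2 * t + 3) := (Nat.mul_le_mul_right _ (by omega)).trans hd
  have h4 : 1 ≤ κ := by
    by_contra! h
    obtain rfl : κ = 0 := by omega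
    have : (1 + t) * (2 * t + 2) ≤
        (Module.finrank K (A ⧸ functionalAnnihilator φ) - 1) * (2 * t + 2) :=
      Nat.mul_le_mul_right _ (by omega)
    nlinarith
  have h5 := hU.quotDim_two_le ht hφ hφκ h3
  have h6 := hU.quotDim_one_eq ht h4 hφ hφκ h5
  refine ⟨functionalAnnihilator φ, fun h => (quotDim_functionalAnnihilator_lt hφ hφκ).ne
    ((quotDim_eq_finrank_iff _ _).2 h), h6, ?_⟩
  refine (hU.map_quotient _).exists_basis ht h6 h5 ?_
  obtain ⟨D, hDe⟩ : ∃ D, Module.finrank K (A ⧸ functionalAnnihilator φ) = D + 1 :=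
    ⟨_, (Nat.sub_add_cancel (by omega)).symm⟩
  rw [hDe] at h1 h3 ⊢
  rw [Nat.add_sub_cancel] at h3
  have h7 : 3 ≤ κ + 1 := by
    by_contra! h
    have : κ = 1 := by omega
    subst this
    nlinarith
  nlinarith

end GeneralPosition

end Existence

section BinaryForms

variable {K : Type*} [Field K]

/-- The monomial `x ^ (t - j) * y ^ j`. -/
noncomputable def binaryMonomial (K : Type*) [Field K] (t j : ℕ) : MvPolynomial (Fin 2) K :=
  X 0 ^ (t - j) * X 1 ^ j

theorem binaryMonomial_eq_monomial (t j : ℕ) : binaryMonomial K t j =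
    monomial (Finsupp.single 0 (t - j) + Finsupp.single 1 j) 1 := by
  rw [binaryMonomial, X_pow_eq_monomial, X_pow_eq_monomial, monomial_mul, one_mul]

theorem isHomogeneous_binaryMonomial {t j : ℕ} (hj : j ≤ t) :
    (binaryMonomial K t j).IsHomogeneous t := by
  have h := ((isHomogeneous_X K (0 : Fin 2)).pow (t - j)).mul
    ((isHomogeneous_X K (1 : Fin 2)).pow j)
  rwa [one_mul, one_mul, Nat.sub_add_cancel hj] at h

theorem linearIndependent_binaryMonomial (t : ℕ) :
    LinearIndependent K fun j : Fin (t + 1) => binaryMonomial K t j := by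
  have h := (basisMonomials (Fin 2) K).linearIndependent.comp
    (fun j : Fin (t + 1) => Finsupp.single 0 (t - j) + Finsupp.single 1 (j : ℕ)) (by
      intro i j hij
      have := DFunLike.congr_fun hij 1
      simpa [Fin.ext_iff] using this)
  rw [coe_basisMonomials] at h
  simp only [binaryMonomial_eq_monomial]
  exact h

theorem span_binaryMonomial (t : ℕ) :
    Submodule.span K (Set.range fun j : Fin (t + 1) => binaryMonomial K t j) =
      homogeneousSubmodule (Fin 2) K t := by
  apply le_antisymm
  · rw [Submodule.span_le]
    rintro _ ⟨j, rfl⟩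
    exact isHomogeneous_binaryMonomial (by omega)
  · intro p hp
    rw [p.as_sum]
    refine Submodule.sum_mem _ fun d hd => ?_
    have hdeg : d.degree = t := by
      by_contra h
      exact mem_support_iff.1 hd (IsHomogeneous.coeff_eq_zero hp h)
    rw [Finsupp.degree_eq_sum, Fin.sum_univ_two] at hdeg
    rw [← mul_one (coeff d p), ← smul_eq_mul, ← smul_monomial]
    refine Submodule.smul_mem _ _ (Submodule.subset_span ⟨⟨d 1, by omega⟩, ?_⟩)
    simp only [binaryMonomial_eq_monomial]
    congr
    ext i
    fin_cases i <;> simp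
    omega

theorem finrank_homogeneousSubmodule_fin_two (t : ℕ) :
    Module.finrank K (homogeneousSubmodule (Fin 2) K t) = t + 1 := by
  rw [← span_binaryMonomial, finrank_span_eq_card (linearIndependent_binaryMonomial t),
    Fintype.card_fin]

end BinaryForms

section HomogeneousForms

variable {K σ R : Type*} [Field K] [CommRing R] [Algebra K R]

theorem aeval_mul_left_of_isHomogeneous {F : MvPolynomial σ K} {m : ℕ}
    (hF : F.IsHomogeneous m) (c : R) (x : σ → R) :
    aeval (fun i => c * x i) F = c ^ m * aeval x F := by
  rw [aeval_def, aeval_def, eval₂_eq, eval₂_eq, Finset.mul_sum]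
  refine Finset.sum_congr rfl fun d hd => ?_
  have hdeg : d.degree = m := by
    by_contra h
    exact mem_support_iff.1 hd (hF.coeff_eq_zero h)
  simp only [mul_pow]
  rw [Finset.prod_mul_distrib, Finset.prod_pow_eq_pow_sum]
  have : ∑ i ∈ d.support, d i = m := hdeg
  rw [this]
  ring

end HomogeneousForms

section RationalNormalCurve

variable {K σ R : Type*} [Field K] [CommRing R] [Algebra K R] {t : ℕ}

theorem exists_mul_eq_of_relations {b : ℕ → R}
    (hb : ∀ i < t, ∀ j < t, b i * b (j + 1) = b (i + 1) * b j) {i : ℕ} (hi : i ≤ t) :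
    ∃ c u v : R, ∀ j ≤ t, b i ^ t * b j = c * (u ^ (t - j) * v ^ j) := by
  rcases hi.lt_or_eq with hi | rfl
  · have h : ∀ j ≤ t, b i ^ j * b j = b (i + 1) ^ j * b 0 := by
      intro j
      induction j with
      | zero => simp
      | succ j ih =>
        intro hj
        linear_combination b i ^ j * hb i hi j (by omega) + b (i + 1) * ih (by omega)
    refine ⟨b 0, b i, b (i + 1), fun j hj => ?_⟩
    obtain ⟨k, rfl⟩ := Nat.exists_eq_add_of_le hj
    rw [Nat.add_sub_cancel_left, pow_add]
    linear_combination b i ^ k * h j hj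
  · rcases i with _ | i
    · exact ⟨b 0, 1, 1, fun j hj => by simp [Nat.le_zero.1 hj]⟩
    have h : ∀ s ≤ i + 1, b (i + 1) ^ s * b (i + 1 - s) = b (i + 1) * b i ^ s := by
      intro s
      induction s with
      | zero => simp
      | succ s ih =>
        intro hs
        have h1 := hb i (by omega) (i + 1 - (s + 1)) (by omega)
        rw [show i + 1 - (s + 1) + 1 = i + 1 - s by omega] at h1
        linear_combination b i * ih (by omega) - b (i + 1) ^ s * h1
    refine ⟨b (i + 1), b i, b (i + 1), fun j hj => ?_⟩
    have h2 := h (i + 1 - j) (by omega)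
    rw [Nat.sub_sub_self hj] at h2
    obtain ⟨k, hk⟩ := Nat.exists_eq_add_of_le hj
    rw [show i + 1 - j = k by omega] at h2 ⊢
    rw [show b (i + 1) ^ (i + 1) = b (i + 1) ^ j * b (i + 1) ^ k by rw [← pow_add, ← hk]]
    linear_combination b (i + 1) ^ j * h2

/-- A form vanishing on a parametrised curve vanishes, up to a factor, at each solution of the
determinantal equations of the rational normal curve. -/
theorem pow_mul_aeval_eq_zero {b : ℕ → R}
    (hb : ∀ i < t, ∀ j < t, b i * b (j + 1) = b (i + 1) * b j)
    {p : σ → MvPolynomial (Fin 2) K} {a : σ → Fin (t + 1) → K}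
    (hp : ∀ l, p l = ∑ j, a l j • binaryMonomial K t j) {q : σ → R}
    (hq : ∀ l, q l = ∑ j, a l j • b j) {F : MvPolynomial σ K} {m : ℕ} (hF : F.IsHomogeneous m)
    (hFp : bind₁ p F = 0) {i : ℕ} (hi : i ≤ t) : b i ^ (t * m) * aeval q F = 0 := by
  obtain ⟨c, u, v, h⟩ := exists_mul_eq_of_relations hb hi
  rw [pow_mul, ← aeval_mul_left_of_isHomogeneous hF]
  have h1 : (fun l => b i ^ t * q l) = fun l => c * aeval ![u, v] (p l) := by
    funext l
    rw [hq, hp, map_sum, Finset.mul_sum, Finset.mul_sum]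
    refine Finset.sum_congr rfl fun j _ => ?_
    rw [mul_smul_comm, h j (by omega), map_smul, mul_smul_comm]
    simp [binaryMonomial]
  rw [h1, aeval_mul_left_of_isHomogeneous hF, ← aeval_bind₁, hFp, map_zero, mul_zero]

theorem aeval_eq_zero_of_relations {b : ℕ → R}
    (hb : ∀ i < t, ∀ j < t, b i * b (j + 1) = b (i + 1) * b j)
    (h1 : (1 : R) ∈ Submodule.span K (b '' Set.Iio (t + 1)))
    {p : σ → MvPolynomial (Fin 2) K} {a : σ → Fin (t + 1) → K}
    (hp : ∀ l, p l = ∑ j, a l j • binaryMonomial K t j) {q : σ → R}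
    (hq : ∀ l, q l = ∑ j, a l j • b j) {F : MvPolynomial σ K} {m : ℕ} (hF : F.IsHomogeneous m)
    (hFp : bind₁ p F = 0) : aeval q F = 0 := by
  have h2 : Ideal.span (b '' Set.Iio (t + 1)) = ⊤ := by
    rw [Ideal.eq_top_iff_one]
    exact Submodule.span_le_restrictScalars K R _ h1
  have h3 := Ideal.span_pow_eq_top _ h2 (t * m)
  have h4 : Ideal.span ((fun x => x ^ (t * m)) '' (b '' Set.Iio (t + 1))) ≤
      Submodule.colon (⊥ : Ideal R) {aeval q F} := by
    rw [Ideal.span_le]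
    rintro _ ⟨_, ⟨i, hi, rfl⟩, rfl⟩
    have : i < t + 1 := hi
    simpa [Submodule.mem_colon_singleton] using
      pow_mul_aeval_eq_zero hb hp hq hF hFp (i := i) (by omega)
  rw [h3, top_le_iff, Ideal.eq_top_iff_one] at h4
  simpa [Submodule.mem_colon_singleton] using h4

variable {p : σ → MvPolynomial (Fin 2) K}

theorem eval_bind₁ (p : σ → MvPolynomial (Fin 2) K) (x : Fin 2 → K) (F : MvPolynomial σ K) :
    eval x (bind₁ p F) = eval (fun i => eval x (p i)) F := by
  have h : (eval x).comp (bind₁ p).toRingHom = eval fun i => eval x (p i) :=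
    ringHom_ext (by simp) (by simp)
  exact RingHom.congr_fun h F

theorem iInf_ker_eval_eq_ker_bind₁ [Infinite K] :
    (⨅ x : Fin 2 → K, RingHom.ker (eval (fun i => eval x (p i)) : MvPolynomial σ K →+* K)) =
      RingHom.ker (bind₁ p) := by
  ext F
  simp only [Ideal.mem_iInf, RingHom.mem_ker]
  simp only [← eval_bind₁]
  constructor
  · intro hF
    exact MvPolynomial.funext fun x => by rw [hF x, map_zero]
  · intro hF x
    rw [hF, map_zero]

theorem isHomogeneous_bind₁ (hp : ∀ i, (p i).IsHomogeneous t) {F : MvPolynomial σ K} {m : ℕ}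
    (hF : F.IsHomogeneous m) : (bind₁ p F).IsHomogeneous (t * m) :=
  hF.aeval p hp

theorem bind₁_homogeneousComponent_eq_zero (ht : 1 ≤ t) (hp : ∀ i, (p i).IsHomogeneous t)
    {F : MvPolynomial σ K} (hF : bind₁ p F = 0) (m : ℕ) :
    bind₁ p (homogeneousComponent m F) = 0 := by
  have h := congrArg (homogeneousComponent (t * m)) hF
  rw [← sum_homogeneousComponent F, map_sum, map_sum, map_zero] at h
  by_cases hm : m ∈ Finset.range (F.totalDegree + 1)
  · rw [Finset.sum_eq_single m] at h
    · rwa [homogeneousComponent_of_mem (isHomogeneous_bind₁ hp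
        (homogeneousComponent_isHomogeneous m F)), if_pos rfl] at h
    · intro l _ hl
      rw [homogeneousComponent_of_mem (isHomogeneous_bind₁ hp
        (homogeneousComponent_isHomogeneous l F)), if_neg]
      intro h'
      exact hl (Nat.eq_of_mul_eq_mul_left ht h').symm
    · exact fun h' => absurd hm h'
  · rw [homogeneousComponent_eq_zero, map_zero]
    simpa using hm

theorem exists_coeffs (hp : ∀ i, (p i).IsHomogeneous t) : ∃ a : σ → Fin (t + 1) → K,
    ∀ l, p l = ∑ j, a l j • binaryMonomial K t j := by
  have h : ∀ l, ∃ c : Fin (t + 1) → K, p l = ∑ j, c j • binaryMonomial K t j := by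
    intro l
    have h1 : p l ∈ homogeneousSubmodule (Fin 2) K t := hp l
    rw [← span_binaryMonomial, Submodule.mem_span_range_iff_exists_fun] at h1
    obtain ⟨c, hc⟩ := h1
    exact ⟨c, hc.symm⟩
  choose a ha using h
  exact ⟨a, ha⟩

theorem map_bind₁_homogeneousSubmodule_one
    (hps : Submodule.span K (Set.range p) = homogeneousSubmodule (Fin 2) K t) :
    (homogeneousSubmodule σ K 1).map (bind₁ p).toLinearMap = homogeneousSubmodule (Fin 2) K t := by
  rw [homogeneousSubmodule_one_eq_span_X, Submodule.map_span, ← Set.range_comp, ← hps]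
  congr 2
  funext i
  simp

/-- A rational normal curve is cut out by quadrics. -/
theorem ker_bind₁_le_of_quadrics [Infinite K] (ht : 1 ≤ t) {p' : σ → MvPolynomial (Fin 2) K}
    (hp : ∀ i, (p i).IsHomogeneous t)
    (hps : Submodule.span K (Set.range p) = homogeneousSubmodule (Fin 2) K t)
    (h : ∀ F : MvPolynomial σ K, F.IsHomogeneous 2 → bind₁ p F = 0 → bind₁ p' F = 0) :
    RingHom.ker (bind₁ p) ≤ RingHom.ker (bind₁ p') := by
  rw [← iInf_ker_eval_eq_ker_bind₁ (p := p')]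
  intro F hF
  rw [← sum_homogeneousComponent F]
  refine Ideal.sum_mem _ fun m _ => ?_
  have hFm := bind₁_homogeneousComponent_eq_zero ht hp hF m
  have hFh := homogeneousComponent_isHomogeneous m F
  generalize homogeneousComponent m F = G at hFm hFh
  rw [Ideal.mem_iInf]
  intro x
  rw [RingHom.mem_ker]
  set q : σ → K := fun i => eval x (p' i) with hq
  have hq2 : ∀ H : MvPolynomial σ K, H.IsHomogeneous 2 → bind₁ p H = 0 → eval q H = 0 := by
    intro H hH hHp
    rw [hq, ← eval_bind₁, h H hH hHp, map_zero]
  obtain ⟨a, ha⟩ := exists_coeffs hp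
  have hL : ∀ j : ℕ, ∃ L : MvPolynomial σ K, L.IsHomogeneous 1 ∧
      (j ≤ t → bind₁ p L = binaryMonomial K t j) := by
    intro j
    by_cases hj : j ≤ t
    · have h1 : binaryMonomial K t j ∈ homogeneousSubmodule (Fin 2) K t :=
        isHomogeneous_binaryMonomial hj
      rw [← map_bind₁_homogeneousSubmodule_one hps] at h1
      obtain ⟨L, hL, hL'⟩ := h1
      exact ⟨L, hL, fun _ => hL'⟩
    · exact ⟨0, isHomogeneous_zero _ _ _, fun h => absurd h hj⟩
  choose L hL1 hLp using hL
  have hb : ∀ i < t, ∀ j < t, eval q (L i) * eval q (L (j + 1)) =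
      eval q (L (i + 1)) * eval q (L j) := by
    intro i hi j hj
    have h1 := hq2 (L i * L (j + 1) - L (i + 1) * L j)
      (((hL1 _).mul (hL1 _)).sub ((hL1 _).mul (hL1 _))) (by
        rw [map_sub, map_mul, map_mul, hLp _ hi.le, hLp _ hj.le, hLp (i + 1) hi,
          hLp (j + 1) hj]
        simp only [binaryMonomial]
        obtain ⟨i', rfl⟩ := Nat.exists_eq_add_of_lt hi
        rw [show i + i' + 1 - i = i' + 1 by omega, show i + i' + 1 - (i + 1) = i' by omega,
          show i + i' + 1 - j = (i + i' + 1 - (j + 1)) + 1 by omega]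
        generalize i + i' + 1 - (j + 1) = e
        ring)
    rw [map_sub, map_mul, map_mul, sub_eq_zero] at h1
    exact h1
  have hqa : ∀ l, q l = ∑ j, a l j • eval q (L (j : ℕ)) := by
    intro l
    have hhom : (X l - ∑ j : Fin (t + 1), a l j • L (j : ℕ)).IsHomogeneous 1 :=
      (isHomogeneous_X K l).sub (IsHomogeneous.sum _ _ _ fun j _ =>
        (homogeneousSubmodule σ K 1).smul_mem _ (hL1 _))
    have hz : bind₁ p (X l - ∑ j : Fin (t + 1), a l j • L (j : ℕ)) = 0 := by
      rw [map_sub, bind₁_X_right, map_sum, ha l, sub_eq_zero]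
      refine Finset.sum_congr rfl fun j _ => ?_
      rw [map_smul, hLp _ (by omega)]
    have h1 := hq2 _ (hhom.mul hhom) (by rw [map_mul, hz, mul_zero])
    rw [map_mul, mul_self_eq_zero, map_sub, eval_X, map_sum, sub_eq_zero] at h1
    rw [h1]
    exact Finset.sum_congr rfl fun j _ => smul_eval _ _ _
  have h1 := fun i (hi : i ≤ t) =>
    pow_mul_aeval_eq_zero (b := fun j => eval q (L j)) hb ha hqa hFh hFm hi
  rw [← aeval_eq_eval]
  by_cases hb0 : ∃ i ≤ t, eval q (L i) ≠ 0
  · obtain ⟨i, hi, hi0⟩ := hb0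
    exact (mul_eq_zero.1 (h1 i hi)).resolve_left (pow_ne_zero _ hi0)
  · push Not at hb0
    rcases Nat.eq_zero_or_pos m with rfl | hm
    · simpa using h1 0 (Nat.zero_le _)
    · have hq0 : q = fun i => 0 * q i := by
        funext l
        rw [hqa, zero_mul]
        exact Finset.sum_eq_zero fun j _ => by rw [hb0 _ (by omega), smul_zero]
      change aeval q G = 0
      rw [hq0, aeval_mul_left_of_isHomogeneous hFh, zero_pow hm.ne', zero_mul]

end RationalNormalCurve

section Coordinates

variable {K : Type} [Field K] {n : ℕ}

theorem mem_saturate_iff {I : Ideal (MvPolynomial (Fin (n + 1)) K)}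
    {F : MvPolynomial (Fin (n + 1)) K} :
    F ∈ saturate I ↔ ∃ k, ∀ G ∈ irrelevantIdeal K n ^ k, F * G ∈ I := by
  rw [saturate, Submodule.mem_iSup_of_directed _
    (Monotone.directed_le fun i j h => Submodule.colon_mono le_rfl (Ideal.pow_le_pow_right h))]
  exact exists_congr fun k => Submodule.mem_colon

theorem exists_linear_nonZeroDivisor [Infinite K] {I : Ideal (MvPolynomial (Fin (n + 1)) K)}
    (hI : saturate I = I) :
    ∃ ℓ ∈ homogeneousSubmodule (Fin (n + 1)) K 1, ∀ F, ℓ * F ∈ I → F ∈ I := by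
  let S := MvPolynomial (Fin (n + 1)) K
  let T := associatedPrimes S (S ⧸ I)
  have hT : T.Finite := associatedPrimes.finite S (S ⧸ I)
  let V : Ideal S → Submodule K (homogeneousSubmodule (Fin (n + 1)) K 1) := fun P =>
    (P.restrictScalars K).comap (homogeneousSubmodule (Fin (n + 1)) K 1).subtype
  have hV : ∀ P ∈ T, V P ≠ ⊤ := by
    intro P hP htop
    obtain ⟨-, x, hx⟩ := isAssociatedPrime_iff.1 hP
    obtain ⟨f, rfl⟩ := Ideal.Quotient.mk_surjective x
    have hmem : ∀ {r : S}, r ∈ P ↔ r * f ∈ I := fun {r} => by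
      rw [hx, Submodule.mem_colon_singleton, Submodule.mem_bot, ← Ideal.Quotient.eq_zero_iff_mem,
        map_mul]
      rfl
    have hf : f ∈ I := by
      rw [← hI, mem_saturate_iff]
      refine ⟨1, fun G hG => ?_⟩
      rw [pow_one] at hG
      have hle : irrelevantIdeal K n ≤ P := by
        rw [irrelevantIdeal, Ideal.span_le]
        rintro _ ⟨i, rfl⟩
        have : (⟨X i, isHomogeneous_X K i⟩ : homogeneousSubmodule (Fin (n + 1)) K 1) ∈ V P :=
          htop ▸ Submodule.mem_top
        exact this
      rw [mul_comm]
      exact hmem.1 (hle hG)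
    have hP1 : (1 : S) ∈ P := hmem.2 (by rwa [one_mul])
    exact (hP.isPrime).ne_top ((Ideal.eq_top_iff_one _).2 hP1)
  have hne := Subspace.biUnion_ne_univ_of_top_notMem (s := hT.toFinset.image V) (by
    simp only [Finset.mem_image, Set.Finite.mem_toFinset, not_exists, not_and]
    exact hV)
  obtain ⟨ℓ, hℓ⟩ := (Set.ne_univ_iff_exists_notMem _).1 hne
  refine ⟨ℓ, ℓ.2, fun F hF => ?_⟩
  by_contra hFI
  have : (ℓ : S) ∈ {r : S | ∃ x : S ⧸ I, x ≠ 0 ∧ r • x = 0} :=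
    ⟨Ideal.Quotient.mk I F, fun h => hFI (Ideal.Quotient.eq_zero_iff_mem.1 h),
      Ideal.Quotient.eq_zero_iff_mem.2 hF⟩
  rw [← biUnion_associatedPrimes_eq_zero_divisors] at this
  simp only [Set.mem_iUnion] at this
  obtain ⟨P, hP, hmem⟩ := this
  refine hℓ ?_
  simp only [Set.mem_iUnion]
  exact ⟨V P, Finset.mem_image_of_mem _ (hT.mem_toFinset.2 hP), hmem⟩

/-- Closure under homogeneous components. -/
def ClosedUnderComponents (J : Ideal (MvPolynomial (Fin (n + 1)) K)) : Prop :=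
  ∀ F ∈ J, ∀ m, homogeneousComponent m F ∈ J

theorem homogeneousComponent_succ_linear_mul {ℓ : MvPolynomial (Fin (n + 1)) K}
    (hℓ : ℓ.IsHomogeneous 1) (F : MvPolynomial (Fin (n + 1)) K) (m : ℕ) :
    homogeneousComponent (m + 1) (ℓ * F) = ℓ * homogeneousComponent m F := by
  conv_lhs => rw [← sum_homogeneousComponent F, Finset.mul_sum, map_sum]
  have h : ∀ i ∈ Finset.range (F.totalDegree + 1),
      homogeneousComponent (m + 1) (ℓ * homogeneousComponent i F) =
        if i = m then ℓ * homogeneousComponent m F else 0 := by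
    intro i _
    rw [homogeneousComponent_of_mem (hℓ.mul (homogeneousComponent_isHomogeneous i F))]
    by_cases him : i = m
    · rw [if_pos him, him, if_pos (add_comm _ _)]
    · rw [if_neg him, if_neg (by omega)]
  rw [Finset.sum_congr rfl h, Finset.sum_ite_eq']
  split_ifs with hm
  · rfl
  · rw [homogeneousComponent_eq_zero _ _ (by simpa using hm), mul_zero]

theorem homogeneousComponent_zero_linear_mul {ℓ : MvPolynomial (Fin (n + 1)) K}
    (hℓ : ℓ.IsHomogeneous 1) (F : MvPolynomial (Fin (n + 1)) K) :
    homogeneousComponent 0 (ℓ * F) = 0 := by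
  have : constantCoeff ℓ = 0 := by
    rw [constantCoeff_eq]
    exact hℓ.coeff_eq_zero (by simp)
  rw [homogeneousComponent_zero, ← constantCoeff_eq, map_mul]
  rw [this, zero_mul, C_0]

theorem mem_sup_span_linear_sub_one {I : Ideal (MvPolynomial (Fin (n + 1)) K)}
    (hI : ClosedUnderComponents I) {ℓ : MvPolynomial (Fin (n + 1)) K} (hℓ : ℓ.IsHomogeneous 1)
    (hreg : ∀ F, ℓ * F ∈ I → F ∈ I) {F : MvPolynomial (Fin (n + 1)) K} {m : ℕ}
    (hF : F.IsHomogeneous m) : F ∈ I ⊔ Ideal.span {ℓ - 1} ↔ F ∈ I := by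
  refine ⟨fun h => ?_, fun h => Ideal.mem_sup_left h⟩
  obtain ⟨G, hG, _, hH, hGH⟩ := Submodule.mem_sup.1 h
  obtain ⟨H, rfl⟩ := Ideal.mem_span_singleton'.1 hH
  have hcomp : ∀ j, homogeneousComponent (j + 1) F = homogeneousComponent (j + 1) G +
      (ℓ * homogeneousComponent j H - homogeneousComponent (j + 1) H) := by
    intro j
    rw [← hGH, map_add, mul_sub, mul_one, mul_comm H, map_sub,
      homogeneousComponent_succ_linear_mul hℓ]
  have hcomp0 : homogeneousComponent 0 F = homogeneousComponent 0 G -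
      homogeneousComponent 0 H := by
    rw [← hGH, map_add, mul_sub, mul_one, mul_comm H, map_sub,
      homogeneousComponent_zero_linear_mul hℓ, zero_sub, sub_eq_add_neg]
  have hlt : ∀ j < m, homogeneousComponent j H ∈ I := by
    intro j
    induction j with
    | zero =>
      intro hm
      rw [homogeneousComponent_of_mem hF, if_neg (by omega)] at hcomp0
      rw [← sub_eq_zero.1 hcomp0.symm]
      exact hI G hG 0
    | succ j ih =>
      intro hm
      have h1 := hcomp j
      rw [homogeneousComponent_of_mem hF, if_neg (by omega)] at h1
      have : homogeneousComponent (j + 1) H =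
          homogeneousComponent (j + 1) G + ℓ * homogeneousComponent j H := by
        linear_combination h1
      rw [this]
      exact I.add_mem (hI G hG _) (I.mul_mem_left _ (ih (by omega)))
  have hge : ∀ i, homogeneousComponent (m + i) H + ℓ ^ i * F ∈ I := by
    intro i
    induction i with
    | zero =>
      rw [pow_zero, one_mul, add_zero]
      obtain _ | j := m
      · rw [homogeneousComponent_of_mem hF, if_pos rfl] at hcomp0
        rw [hcomp0, add_sub_cancel]
        exact hI G hG 0
      · have h1 := hcomp j
        rw [homogeneousComponent_of_mem hF, if_pos rfl] at h1
        have : homogeneousComponent (j + 1) H + F =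
            homogeneousComponent (j + 1) G + ℓ * homogeneousComponent j H := by
          linear_combination h1
        rw [this]
        exact I.add_mem (hI G hG _) (I.mul_mem_left _ (hlt j (by omega)))
    | succ i ih =>
      have h1 := hcomp (m + i)
      rw [homogeneousComponent_of_mem hF, if_neg (by omega)] at h1
      have : homogeneousComponent (m + (i + 1)) H + ℓ ^ (i + 1) * F =
          homogeneousComponent (m + i + 1) G +
            ℓ * (homogeneousComponent (m + i) H + ℓ ^ i * F) := by
        rw [← add_assoc m i 1, pow_succ]
        linear_combination h1
      rw [this]
      exact I.add_mem (hI G hG _) (I.mul_mem_left _ ih)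
  have hpow := hge (H.totalDegree + 1)
  rw [homogeneousComponent_eq_zero _ _ (by omega), zero_add] at hpow
  generalize H.totalDegree + 1 = N at hpow
  induction N with
  | zero => rwa [pow_zero, one_mul] at hpow
  | succ N ih => exact ih (hreg _ (by rwa [← mul_assoc, ← pow_succ']))

end Coordinates

section AffineModel

variable {K : Type} [Field K] {n : ℕ}

instance finiteDimensional_homogeneousSubmodule {σ : Type*} [Finite σ] (m : ℕ) :
    FiniteDimensional K (homogeneousSubmodule σ K m) :=
  Module.Finite.iff_fg.2 (homogeneousSubmodule_fg _ _ _)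

/-- The coordinate ring `A` of the finite scheme with ideal `I`, as a quotient of the homogeneous
coordinate ring by dehomogenization along a linear form `ℓ`. -/
structure AffineModel (I : Ideal (MvPolynomial (Fin (n + 1)) K)) (A : Type) [CommRing A]
    [Algebra K A] where
  /-- The dehomogenization map. -/
  ev : MvPolynomial (Fin (n + 1)) K →ₐ[K] A
  /-- The linear form not vanishing on the scheme. -/
  ℓ : MvPolynomial (Fin (n + 1)) K
  surjective : Function.Surjective ev
  isHomogeneous : ℓ.IsHomogeneous 1
  ev_ℓ : ev ℓ = 1
  ev_eq_zero_iff : ∀ {m F}, F.IsHomogeneous m → (ev F = 0 ↔ F ∈ I)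
  closed : ClosedUnderComponents I

namespace AffineModel

variable {I : Ideal (MvPolynomial (Fin (n + 1)) K)} {A : Type} [CommRing A] [Algebra K A]
  (E : AffineModel I A)

/-- The space of functions on the scheme which come from forms of degree `m`. -/
noncomputable def U (m : ℕ) : Submodule K A :=
  (homogeneousSubmodule (Fin (n + 1)) K m).map E.ev.toLinearMap

variable {E}

theorem mem_U {m : ℕ} {a : A} : a ∈ E.U m ↔ ∃ F, F.IsHomogeneous m ∧ E.ev F = a :=
  Iff.rfl

theorem one_mem_U (m : ℕ) : 1 ∈ E.U m :=
  ⟨E.ℓ ^ m, by simpa using E.isHomogeneous.pow m, by simp [E.ev_ℓ]⟩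

theorem mul_mem_U {i j : ℕ} {a b : A} (ha : a ∈ E.U i) (hb : b ∈ E.U j) : a * b ∈ E.U (i + j) := by
  obtain ⟨F, hF, rfl⟩ := ha
  obtain ⟨G, hG, rfl⟩ := hb
  exact ⟨F * G, IsHomogeneous.mul hF hG, map_mul E.ev F G⟩

theorem U_mono : Monotone E.U := monotone_nat_of_le_succ fun m a ha => by
  simpa using mul_mem_U ha (one_mem_U (E := E) 1)

instance finiteDimensional_U (m : ℕ) : FiniteDimensional K (E.U m) :=
  Module.Finite.map _ _

theorem exists_mem_U (a : A) : ∃ m, a ∈ E.U m := by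
  obtain ⟨F, rfl⟩ := E.surjective a
  refine ⟨F.totalDegree, ?_⟩
  conv_rhs => rw [← sum_homogeneousComponent F, map_sum]
  exact Submodule.sum_mem _ fun i hi => U_mono (Finset.mem_range_succ_iff.1 hi)
    ⟨_, homogeneousComponent_isHomogeneous i F, rfl⟩

theorem hilbF_eq (m : ℕ) : hilbF I m = Module.finrank K (E.U m) :=
  finrank_map_eq_of_ker_s5 fun F hF => by
    simpa [Ideal.Quotient.eq_zero_iff_mem] using (E.ev_eq_zero_iff hF).symm

theorem exists_U_eq_top {d : ℕ} (h : ∀ᶠ m : ℕ in atTop, hilbF I m = d) :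
    ∃ M, ∀ m, M ≤ m → E.U m = ⊤ := by
  obtain ⟨M, hM⟩ := eventually_atTop.1 h
  suffices hM' : E.U M = ⊤ from ⟨M, fun m hm => top_unique (hM' ▸ U_mono hm)⟩
  refine top_unique fun a _ => ?_
  obtain ⟨m, hm⟩ := exists_mem_U (E := E) a
  have : E.U M = E.U (max m M) := Submodule.eq_of_le_of_finrank_eq (U_mono (le_max_right _ _)) (by
    rw [← hilbF_eq, ← hilbF_eq, hM _ le_rfl, hM _ (le_max_right _ _)])
  rw [this]
  exact U_mono (le_max_left _ _) hm

theorem ev_eq_zero_of_mem {F : MvPolynomial (Fin (n + 1)) K} (hF : F ∈ I) : E.ev F = 0 := by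
  rw [← sum_homogeneousComponent F, map_sum]
  exact Finset.sum_eq_zero fun i _ =>
    (E.ev_eq_zero_iff (homogeneousComponent_isHomogeneous i F)).2 (E.closed F hF i)

theorem exists_homogenization {J : Ideal (MvPolynomial (Fin (n + 1)) K)}
    (hJ : ClosedUnderComponents J) {H : MvPolynomial (Fin (n + 1)) K} (hH : H ∈ J) {N : ℕ}
    (hN : H.totalDegree ≤ N) : ∃ Y ∈ J, Y.IsHomogeneous N ∧ E.ev Y = E.ev H := by
  refine ⟨∑ j ∈ Finset.range (H.totalDegree + 1), E.ℓ ^ (N - j) * homogeneousComponent j H,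
    J.sum_mem fun j _ => J.mul_mem_left _ (hJ H hH j), IsHomogeneous.sum _ _ _ fun j hj => ?_, ?_⟩
  · have h := (E.isHomogeneous.pow (N - j)).mul (homogeneousComponent_isHomogeneous j H)
    rwa [one_mul, Nat.sub_add_cancel ((Finset.mem_range_succ_iff.1 hj).trans hN)] at h
  · conv_rhs => rw [← sum_homogeneousComponent H]
    simp [E.ev_ℓ]

end AffineModel

theorem irrelevantIdeal_pow_le (k : ℕ) : irrelevantIdeal K n ^ k ≤
    Ideal.span (homogeneousSubmodule (Fin (n + 1)) K k : Set (MvPolynomial (Fin (n + 1)) K)) := by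
  induction k with
  | zero =>
    rw [pow_zero, Ideal.one_eq_top, top_le_iff, Ideal.eq_top_iff_one]
    exact Ideal.subset_span (isHomogeneous_one _ _)
  | succ k ih =>
    rw [pow_succ]
    refine (Ideal.mul_mono ih le_rfl).trans ?_
    rw [irrelevantIdeal, Ideal.span_mul_span', Ideal.span_le]
    rintro _ ⟨F, hF, _, ⟨i, rfl⟩, rfl⟩
    exact Ideal.subset_span (IsHomogeneous.mul hF (isHomogeneous_X K i))

theorem linear_mem_irrelevantIdeal {ℓ : MvPolynomial (Fin (n + 1)) K} (hℓ : ℓ.IsHomogeneous 1) :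
    ℓ ∈ irrelevantIdeal K n := by
  have : ℓ ∈ homogeneousSubmodule (Fin (n + 1)) K 1 := hℓ
  rw [homogeneousSubmodule_one_eq_span_X] at this
  have h : Submodule.span K (Set.range X) ≤ (irrelevantIdeal K n).restrictScalars K :=
    Submodule.span_le.2 Ideal.subset_span
  exact h this

namespace AffineModel

variable {I : Ideal (MvPolynomial (Fin (n + 1)) K)} {A : Type} [CommRing A] [Algebra K A]
  {E : AffineModel I A}

theorem mem_interIdeal_iff {M : ℕ} (hM : E.U M = ⊤) {J : Ideal (MvPolynomial (Fin (n + 1)) K)}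
    (hJ : ClosedUnderComponents J) {F : MvPolynomial (Fin (n + 1)) K} {m : ℕ}
    (hF : F.IsHomogeneous m) : F ∈ interIdeal I J ↔ E.ev F ∈ J.map E.ev := by
  rw [interIdeal, mem_saturate_iff]
  constructor
  · rintro ⟨k, hk⟩
    obtain ⟨P, hP, Q, hQ, hPQ⟩ := Submodule.mem_sup.1
      (hk _ (Ideal.pow_mem_pow (linear_mem_irrelevantIdeal E.isHomogeneous) k))
    have h := congrArg E.ev hPQ
    rw [map_add, ev_eq_zero_of_mem hP, zero_add, map_mul, map_pow, E.ev_ℓ, one_pow, mul_one] at h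
    exact h ▸ Ideal.mem_map_of_mem _ hQ
  · intro h
    obtain ⟨G, hG, hGF⟩ := (Ideal.mem_map_iff_of_surjective E.ev E.surjective).1 h
    refine ⟨G.totalDegree + M, fun Y hY => ?_⟩
    have key : Ideal.span (homogeneousSubmodule (Fin (n + 1)) K (G.totalDegree + M) :
        Set (MvPolynomial (Fin (n + 1)) K)) ≤ Submodule.colon (I ⊔ J) {F} := by
      rw [Ideal.span_le]
      intro X hX
      rw [SetLike.mem_coe, Submodule.mem_colon_singleton, smul_eq_mul, mul_comm]
      obtain ⟨X', hX', hXX'⟩ := mem_U.1 (hM ▸ Submodule.mem_top : E.ev X ∈ E.U M)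
      obtain ⟨Z, hZJ, hZ, hZe⟩ := exists_homogenization (E := E) hJ (J.mul_mem_right X' hG)
        (N := m + (G.totalDegree + M))
        ((totalDegree_mul _ _).trans (by have := IsHomogeneous.totalDegree_le hX'; omega))
      have hI : F * X - Z ∈ I := (E.ev_eq_zero_iff ((hF.mul hX).sub hZ)).1 (by
        rw [map_sub, hZe, map_mul, map_mul, hGF, hXX', sub_self])
      simpa using (I ⊔ J).add_mem (Ideal.mem_sup_left hI) (Ideal.mem_sup_right hZJ)
    have := key (irrelevantIdeal_pow_le _ hY)
    rwa [Submodule.mem_colon_singleton, smul_eq_mul, mul_comm] at this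

theorem hilbF_interIdeal {M : ℕ} (hM : E.U M = ⊤) {J : Ideal (MvPolynomial (Fin (n + 1)) K)}
    (hJ : ClosedUnderComponents J) (m : ℕ) :
    hilbF (interIdeal I J) m = quotDim (J.map E.ev) (E.U m) := by
  rw [hilbF, quotDim, U, ← Submodule.map_comp]
  refine finrank_map_eq_of_ker_s5 fun F hF => ?_
  simpa [Ideal.Quotient.eq_zero_iff_mem] using mem_interIdeal_iff hM hJ hF

theorem hilbF_eq_quotDim_bot (m : ℕ) : hilbF I m = quotDim ⊥ (E.U m) := by
  rw [hilbF, quotDim, U, ← Submodule.map_comp]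
  refine finrank_map_eq_of_ker_s5 fun F hF => ?_
  simpa [Ideal.Quotient.eq_zero_iff_mem] using (E.ev_eq_zero_iff hF).symm

section Invariants

variable {I' : Ideal (MvPolynomial (Fin (n + 1)) K)} {𝔞 : Ideal A}
  (hI' : ∀ m, hilbF I' m = quotDim 𝔞 (E.U m)) {M : ℕ} (hM : ∀ m, M ≤ m → E.U m = ⊤)
include hI' hM

theorem schemeDeg_eq : schemeDeg I' = Module.finrank K (A ⧸ 𝔞) := by
  have h : ∀ᶠ m : ℕ in atTop, hilbF I' m = Module.finrank K (A ⧸ 𝔞) :=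
    eventually_atTop.2 ⟨M, fun m hm => by rw [hI', hM m hm, quotDim_top]⟩
  have h' : ∃ d : ℕ, ∀ᶠ m : ℕ in atTop, hilbF I' m = d := ⟨_, h⟩
  rw [schemeDeg, dif_pos h']
  obtain ⟨m, h1, h2⟩ := (h'.choose_spec.and h).exists
  exact h1.symm.trans h2

theorem schemeReg_le_iff [FiniteDimensional K A] {k : ℕ} :
    schemeReg I' ≤ k + 1 ↔ E.U k ⊔ 𝔞.restrictScalars K = ⊤ := by
  have key : ∀ m, hilbF I' m = schemeDeg I' ↔ E.U m ⊔ 𝔞.restrictScalars K = ⊤ := fun m => by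
    rw [hI', schemeDeg_eq hI' hM, quotDim_eq_finrank_iff]
  constructor
  · intro h
    have hmem := Nat.sInf_mem (s := {p : ℕ | 1 ≤ p ∧ ∀ m : ℕ, p - 1 ≤ m →
      hilbF I' m = schemeDeg I'}) ⟨M + 1, by omega, fun m hm => (key m).2 (by
        rw [hM m (by omega), top_sup_eq])⟩
    exact (key k).1 (hmem.2 k (by rw [schemeReg] at h; omega))
  · intro h
    exact Nat.sInf_le ⟨by omega, fun m hm => (key m).2 (top_unique (h ▸ sup_le_sup_right
      (U_mono (by omega)) _))⟩

end Invariants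

end AffineModel

theorem exists_affineModel [Infinite K] {I : Ideal (MvPolynomial (Fin (n + 1)) K)}
    (hI : IsFiniteSubscheme I) :
    ∃ (A : Type) (_ : CommRing A) (_ : Algebra K A), Nonempty (AffineModel I A) := by
  obtain ⟨ℓ, hℓ, hreg⟩ := exists_linear_nonZeroDivisor hI.saturated
  have hcl : ClosedUnderComponents I := fun F hF m => homogeneousComponent_mem_of_mem hI.homog hF m
  refine ⟨MvPolynomial (Fin (n + 1)) K ⧸ (I ⊔ Ideal.span {ℓ - 1}), inferInstance, inferInstance,
    ⟨Ideal.Quotient.mkₐ K _, ℓ, Ideal.Quotient.mkₐ_surjective K _, hℓ, ?_, ?_, hcl⟩⟩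
  · rw [← sub_eq_zero, ← map_one (Ideal.Quotient.mkₐ K _), ← map_sub, Ideal.Quotient.mkₐ_eq_mk,
      Ideal.Quotient.eq_zero_iff_mem]
    exact Ideal.mem_sup_right (Ideal.subset_span rfl)
  · intro m F hF
    rw [Ideal.Quotient.mkₐ_eq_mk, Ideal.Quotient.eq_zero_iff_mem,
      mem_sup_span_linear_sub_one hcl hℓ hreg hF]

end AffineModel

section QuotientDimension

variable {K A : Type*} [Field K] [CommRing A] [Algebra K A] [FiniteDimensional K A]

theorem finrank_quotient_add_le (𝔞 𝔟 : Ideal A) :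
    Module.finrank K (A ⧸ 𝔞) + Module.finrank K (A ⧸ 𝔟) ≤
      Module.finrank K (A ⧸ (𝔞 ⊔ 𝔟)) + Module.finrank K A := by
  have h := Submodule.finrank_sup_add_finrank_inf_eq (𝔞.restrictScalars K) (𝔟.restrictScalars K)
  have hsup : 𝔞.restrictScalars K ⊔ 𝔟.restrictScalars K = (𝔞 ⊔ 𝔟).restrictScalars K := by
    ext x
    simp [Submodule.mem_sup]
  rw [hsup] at h
  have ha := finrank_quotient_add_finrank_ideal (K := K) 𝔞
  have hb := finrank_quotient_add_finrank_ideal (K := K) 𝔟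
  have hs := finrank_quotient_add_finrank_ideal (K := K) (𝔞 ⊔ 𝔟)
  omega

end QuotientDimension

section Curves

variable {K : Type} [Field K] {n : ℕ}

theorem closedUnderComponents_span {W : Submodule K (MvPolynomial (Fin (n + 1)) K)} {m : ℕ}
    (hW : W ≤ homogeneousSubmodule (Fin (n + 1)) K m) :
    ClosedUnderComponents (Ideal.span (W : Set (MvPolynomial (Fin (n + 1)) K))) :=
  fun _ hF k => homogeneousComponent_mem_of_mem
    (Ideal.homogeneous_span _ _ fun _ hx => ⟨m, hW hx⟩) hF k

theorem finrank_homogeneousSubmodule_one :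
    Module.finrank K (homogeneousSubmodule (Fin (n + 1)) K 1) = n + 1 := by
  rw [homogeneousSubmodule_one_eq_span_X,
    finrank_span_eq_card (linearIndependent_X (Fin (n + 1)) K), Fintype.card_fin]

theorem closedUnderComponents_ker_bind₁ {t : ℕ} (ht : 1 ≤ t)
    {p : Fin (n + 1) → MvPolynomial (Fin 2) K} (hp : ∀ i, (p i).IsHomogeneous t) :
    ClosedUnderComponents (RingHom.ker (bind₁ p)) :=
  fun _ hF m => bind₁_homogeneousComponent_eq_zero ht hp hF m

theorem finrank_linear_inf_ker_bind₁ {t : ℕ} {p : Fin (n + 1) → MvPolynomial (Fin 2) K}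
    (hps : Submodule.span K (Set.range p) = homogeneousSubmodule (Fin 2) K t) :
    Module.finrank K ↥(homogeneousSubmodule (Fin (n + 1)) K 1 ⊓
      LinearMap.ker (bind₁ p).toLinearMap) + t = n := by
  have h := finrank_map_add_finrank_inf_ker (homogeneousSubmodule (Fin (n + 1)) K 1)
    (bind₁ p).toLinearMap
  rw [map_bind₁_homogeneousSubmodule_one hps, finrank_homogeneousSubmodule_fin_two,
    finrank_homogeneousSubmodule_one] at h
  omega

/-- The span of a rational normal curve is the only linear subspace of the right dimension
containing it. -/
theorem isLinearSubspace_and_le_ker_bind₁_iff {t : ℕ} {p : Fin (n + 1) → MvPolynomial (Fin 2) K}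
    (hps : Submodule.span K (Set.range p) = homogeneousSubmodule (Fin 2) K t)
    {Λ : Ideal (MvPolynomial (Fin (n + 1)) K)} :
    IsLinearSubspace Λ t ∧ Λ ≤ RingHom.ker (bind₁ p) ↔
      Λ = Ideal.span ((homogeneousSubmodule (Fin (n + 1)) K 1 ⊓
        LinearMap.ker (bind₁ p).toLinearMap : Submodule K (MvPolynomial (Fin (n + 1)) K)) :
          Set (MvPolynomial (Fin (n + 1)) K)) := by
  have hfin := finrank_linear_inf_ker_bind₁ hps
  constructor
  · rintro ⟨⟨W, hW1, hWn, rfl⟩, hle⟩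
    have hW : W ≤ homogeneousSubmodule (Fin (n + 1)) K 1 ⊓ LinearMap.ker (bind₁ p).toLinearMap :=
      le_inf hW1 fun x hx => hle (Ideal.subset_span hx)
    rw [Submodule.eq_of_le_of_finrank_eq hW (by omega)]
  · rintro rfl
    exact ⟨⟨_, inf_le_left, hfin, rfl⟩, Ideal.span_le.2 fun x hx => hx.2⟩

namespace AffineModel

variable {I : Ideal (MvPolynomial (Fin (n + 1)) K)} {A : Type} [CommRing A] [Algebra K A]
  [FiniteDimensional K A] {E : AffineModel I A}

theorem generalPosition {M : ℕ} (hM : ∀ m, M ≤ m → E.U m = ⊤) :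
    GeneralPosition E.U (tInv I) where
  one_mem := one_mem_U
  mul_mem := mul_mem_U
  finrank_le 𝔞 h𝔞 := by
    obtain hs | ⟨s, hs⟩ : quotDim 𝔞 (E.U 1) = 0 ∨ ∃ s, quotDim 𝔞 (E.U 1) = s + 1 := by
      cases h : quotDim 𝔞 (E.U 1) <;> simp
    · rw [quotDim, Submodule.finrank_eq_zero] at hs
      have h1 : Ideal.Quotient.mkₐ K 𝔞 1 = 0 := by
        rw [← Submodule.mem_bot K, ← hs]
        exact ⟨1, one_mem_U 1, rfl⟩
      have htop : 𝔞 = ⊤ := by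
        rw [Ideal.eq_top_iff_one, ← Ideal.Quotient.eq_zero_iff_mem]
        exact h1
      subst htop
      have : Subsingleton (A ⧸ (⊤ : Ideal A)) := Ideal.Quotient.subsingleton_iff.2 rfl
      rw [Module.finrank_zero_of_subsingleton]
      exact Nat.zero_le _
    · let g := (Ideal.Quotient.mkₐ K 𝔞).toLinearMap ∘ₗ E.ev.toLinearMap
      let W := homogeneousSubmodule (Fin (n + 1)) K 1 ⊓ LinearMap.ker g
      have hW : Module.finrank K ((homogeneousSubmodule (Fin (n + 1)) K 1).map g) +
          Module.finrank K W = _ := finrank_map_add_finrank_inf_ker _ g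
      have hmap : Module.finrank K ((homogeneousSubmodule (Fin (n + 1)) K 1).map g) = s + 1 := by
        rw [← hs, quotDim, U, ← Submodule.map_comp]
      rw [hmap, finrank_homogeneousSubmodule_one] at hW
      have hlin : IsLinearSubspace (Ideal.span (W : Set (MvPolynomial (Fin (n + 1)) K))) s :=
        ⟨W, inf_le_left, by omega, rfl⟩
      have hnot : ¬ HasSecantPlane I s :=
        Nat.notMem_of_lt_sInf (s := {t | HasSecantPlane I t}) (by rw [tInv] at h𝔞; omega)
      have hle : (Ideal.span (W : Set (MvPolynomial (Fin (n + 1)) K))).map E.ev ≤ 𝔞 := by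
        rw [Ideal.map_le_iff_le_comap, Ideal.span_le]
        exact fun x hx => (Ideal.Quotient.eq_zero_iff_mem (I := 𝔞)).1 hx.2
      have hdeg := schemeDeg_eq (hilbF_interIdeal (hM M le_rfl)
        (closedUnderComponents_span (W := W) inf_le_left)) hM
      have := finrank_quotient_anti (K := K) hle
      rw [hs]
      by_contra hcon
      exact hnot ⟨_, hlin, by rw [hdeg]; omega⟩

theorem exists_rationalNormalCurve [IsAlgClosed K] {t κ : ℕ} (hU : GeneralPosition E.U t)
    (ht : 1 ≤ t) (hκ : E.U (κ + 1) ≠ ⊤)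
    (hd : (Module.finrank K A - 1) * (2 * t + 2) ≤ κ * t * (2 * t + 3)) :
    ∃ p : Fin (n + 1) → MvPolynomial (Fin 2) K, (∀ i, (p i).IsHomogeneous t) ∧
      Submodule.span K (Set.range p) = homogeneousSubmodule (Fin 2) K t ∧
      E.U (κ + 1) ⊔ ((RingHom.ker (bind₁ p)).map E.ev).restrictScalars K ≠ ⊤ := by
  obtain ⟨𝔫, h𝔫, hdim, b, hspan, hb⟩ := hU.exists_castelnuovo_quotient ht hκ hd
  let v : Fin (n + 1) → A ⧸ 𝔫 := fun i => Ideal.Quotient.mkₐ K 𝔫 (E.ev (X i))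
  let β := Fintype.linearCombination K fun j : Fin (t + 1) => b j
  let μ := Fintype.linearCombination K fun j : Fin (t + 1) => binaryMonomial K t j
  have hβ : LinearMap.range β = (E.U 1).map (Ideal.Quotient.mkₐ K 𝔫).toLinearMap := by
    rw [← hspan, Fintype.range_linearCombination]
    congr 1
    ext x
    constructor
    · rintro ⟨j, rfl⟩
      exact ⟨j, j.2, rfl⟩
    · rintro ⟨j, hj, rfl⟩
      exact ⟨⟨j, hj⟩, rfl⟩
  have hv : Submodule.span K (Set.range v) = LinearMap.range β := by
    rw [hβ, U, homogeneousSubmodule_one_eq_span_X, ← Submodule.map_comp, Submodule.map_span,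
      ← Set.range_comp]
    rfl
  have hβinj : Function.Injective β := by
    have h := LinearMap.finrank_range_add_finrank_ker β
    rw [hβ, Module.finrank_fin_fun] at h
    rw [quotDim] at hdim
    rw [← LinearMap.ker_eq_bot, ← Submodule.finrank_eq_zero (R := K)]
    omega
  have ha : ∀ i, ∃ a, β a = v i := fun i =>
    LinearMap.mem_range.1 (hv ▸ Submodule.subset_span (Set.mem_range_self i))
  choose a ha using ha
  have hatop : Submodule.span K (Set.range a) = ⊤ := by
    apply Submodule.map_injective_of_injective hβinj
    rw [Submodule.map_span, ← Set.range_comp, Submodule.map_top, ← hv]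
    congr 2
    exact funext ha
  have hps : Submodule.span K (Set.range fun i => μ (a i)) = homogeneousSubmodule (Fin 2) K t := by
    rw [← span_binaryMonomial, ← Fintype.range_linearCombination K fun j : Fin (t + 1) =>
      binaryMonomial K t j, LinearMap.range_eq_map, ← hatop, Submodule.map_span, ← Set.range_comp]
    rfl
  refine ⟨fun i => μ (a i), fun i => ?_, hps, fun htop => h𝔫 (top_unique ?_)⟩
  · have : μ (a i) ∈ homogeneousSubmodule (Fin 2) K t :=
      hps ▸ Submodule.subset_span (Set.mem_range_self i)
    exact this
  rw [← htop]
  refine sup_le_sup_left (Ideal.map_le_iff_le_comap.2 fun F hF => ?_) _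
  have hp : ∀ i, (μ (a i)).IsHomogeneous t := fun i => by
    have : μ (a i) ∈ homogeneousSubmodule (Fin 2) K t :=
      hps ▸ Submodule.subset_span (Set.mem_range_self i)
    exact this
  have haev : aeval v = (Ideal.Quotient.mkₐ K 𝔫).comp E.ev := by
    ext i
    simp [v]
  have h1 : (1 : A ⧸ 𝔫) ∈ Submodule.span K (b '' Set.Iio (t + 1)) := by
    rw [hspan]
    exact ⟨1, one_mem_U 1, map_one (Ideal.Quotient.mkₐ K 𝔫)⟩
  have h0 : aeval v F = 0 := by
    rw [← sum_homogeneousComponent F, map_sum]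
    exact Finset.sum_eq_zero fun m _ => aeval_eq_zero_of_relations hb h1
      (a := a) (fun _ => rfl) (fun l => (ha l).symm) (homogeneousComponent_isHomogeneous m F)
      (bind₁_homogeneousComponent_eq_zero ht hp hF m)
  rw [haev] at h0
  exact (Ideal.Quotient.eq_zero_iff_mem (I := 𝔫)).1 h0

omit [FiniteDimensional K A] in
/-- The quadrics containing a rational normal curve are determined by any subscheme on it of
length at least `2 t + 1`. -/
theorem ker_bind₁_quadric_iff {t : ℕ} {p : Fin (n + 1) → MvPolynomial (Fin 2) K}
    (hp : ∀ i, (p i).IsHomogeneous t) {𝔞 : Ideal A} (h𝔞 : (RingHom.ker (bind₁ p)).map E.ev ≤ 𝔞)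
    (hdim : 2 * t + 1 ≤ quotDim 𝔞 (E.U 2)) {F : MvPolynomial (Fin (n + 1)) K}
    (hF : F.IsHomogeneous 2) : bind₁ p F = 0 ↔ E.ev F ∈ 𝔞 := by
  let g := (Ideal.Quotient.mkₐ K 𝔞).toLinearMap ∘ₗ E.ev.toLinearMap
  have h1 := finrank_map_add_finrank_inf_ker (homogeneousSubmodule (Fin (n + 1)) K 2) g
  have h2 := finrank_map_add_finrank_inf_ker (homogeneousSubmodule (Fin (n + 1)) K 2)
    (bind₁ p).toLinearMap
  have hmap : Module.finrank K ((homogeneousSubmodule (Fin (n + 1)) K 2).map g) =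
      quotDim 𝔞 (E.U 2) := by
    rw [quotDim, U, ← Submodule.map_comp]
  have hle : (homogeneousSubmodule (Fin (n + 1)) K 2).map (bind₁ p).toLinearMap ≤
      homogeneousSubmodule (Fin 2) K (t * 2) := by
    rintro _ ⟨G, hG, rfl⟩
    exact isHomogeneous_bind₁ hp hG
  have h3 := Submodule.finrank_mono hle
  rw [finrank_homogeneousSubmodule_fin_two] at h3
  have hker : homogeneousSubmodule (Fin (n + 1)) K 2 ⊓ LinearMap.ker (bind₁ p).toLinearMap ≤
      homogeneousSubmodule (Fin (n + 1)) K 2 ⊓ LinearMap.ker g :=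
    inf_le_inf_left _ fun G hG =>
      Ideal.Quotient.eq_zero_iff_mem.2 (h𝔞 (Ideal.mem_map_of_mem E.ev hG))
  have heq := Submodule.eq_of_le_of_finrank_le hker (by omega)
  refine ⟨fun h => h𝔞 (Ideal.mem_map_of_mem E.ev h), fun h => ?_⟩
  have : F ∈ homogeneousSubmodule (Fin (n + 1)) K 2 ⊓ LinearMap.ker g :=
    ⟨hF, Ideal.Quotient.eq_zero_iff_mem.2 h⟩
  rw [← heq] at this
  exact this.2

theorem ker_bind₁_eq [IsAlgClosed K] {t κ : ℕ} (hU : GeneralPosition E.U t) (ht : 1 ≤ t)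
    (hd : (Module.finrank K A - 1) * (2 * t + 2) ≤ κ * t * (2 * t + 3))
    {p p' : Fin (n + 1) → MvPolynomial (Fin 2) K}
    (hp : ∀ i, (p i).IsHomogeneous t)
    (hps : Submodule.span K (Set.range p) = homogeneousSubmodule (Fin 2) K t)
    (hpκ : E.U (κ + 1) ⊔ ((RingHom.ker (bind₁ p)).map E.ev).restrictScalars K ≠ ⊤)
    (hp' : ∀ i, (p' i).IsHomogeneous t)
    (hps' : Submodule.span K (Set.range p') = homogeneousSubmodule (Fin 2) K t)
    (hpκ' : E.U (κ + 1) ⊔ ((RingHom.ker (bind₁ p')).map E.ev).restrictScalars K ≠ ⊤) :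
    RingHom.ker (bind₁ p) = RingHom.ker (bind₁ p') := by
  have h1 := hU.le_finrank_of_ne_top hpκ
  have h2 := hU.le_finrank_of_ne_top hpκ'
  have h3 := finrank_quotient_add_le (K := K) ((RingHom.ker (bind₁ p)).map E.ev)
    ((RingHom.ker (bind₁ p')).map E.ev)
  have h4 := hU.min_le_quotDim 2 ((RingHom.ker (bind₁ p)).map E.ev ⊔
    (RingHom.ker (bind₁ p')).map E.ev)
  have h5 : Module.finrank K A - 1 ≤ 2 * (κ * t) := by
    by_contra! hcon
    have := Nat.mul_le_mul_right (2 * t + 2) hcon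
    nlinarith
  have h6 : 2 * t + 1 ≤ quotDim ((RingHom.ker (bind₁ p)).map E.ev ⊔
      (RingHom.ker (bind₁ p')).map E.ev) (E.U 2) := by
    refine le_trans (le_min ?_ le_rfl) h4
    rw [add_mul, one_mul] at h1 h2
    omega
  have h7 : ∀ F : MvPolynomial (Fin (n + 1)) K, F.IsHomogeneous 2 →
      (bind₁ p F = 0 ↔ bind₁ p' F = 0) := fun F hF => by
    rw [ker_bind₁_quadric_iff hp le_sup_left h6 hF, ker_bind₁_quadric_iff hp' le_sup_right h6 hF]
  exact le_antisymm (ker_bind₁_le_of_quadrics ht hp hps fun F hF => (h7 F hF).1)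
    (ker_bind₁_le_of_quadrics ht hp' hps' fun F hF => (h7 F hF).2)

end AffineModel

end Curves

theorem regularity_bound {d t r : ℕ} (hd : 1 ≤ d) (ht : 1 ≤ t)
    (h : ⌈((d : ℚ) - 1) / ((t : ℚ) + (t : ℚ) / (2 * (t : ℚ) + 2))⌉ + 2 < (r : ℤ)) :
    ∃ κ : ℕ, r = κ + 3 ∧ (d - 1) * (2 * t + 2) ≤ κ * t * (2 * t + 3) := by
  have ht0 : (0 : ℚ) < t := by exact_mod_cast ht
  have hd0 : (1 : ℚ) ≤ d := by exact_mod_cast hd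
  have hden : (0 : ℚ) < t + t / (2 * t + 2) := by positivity
  have hx : 0 ≤ ((d : ℚ) - 1) / ((t : ℚ) + (t : ℚ) / (2 * (t : ℚ) + 2)) :=
    div_nonneg (by linarith) hden.le
  have hc := Int.ceil_nonneg hx
  obtain ⟨κ, rfl⟩ : ∃ κ, r = κ + 3 := ⟨r - 3, by omega⟩
  refine ⟨κ, rfl, ?_⟩
  have h2 : ⌈((d : ℚ) - 1) / ((t : ℚ) + (t : ℚ) / (2 * (t : ℚ) + 2))⌉ ≤ (κ : ℤ) := by
    push_cast at h
    omega
  rw [Int.ceil_le, div_le_iff₀ hden] at h2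
  have h3 : ((d : ℚ) - 1) * (2 * t + 2) ≤ κ * t * (2 * t + 3) := by
    have h4 := mul_le_mul_of_nonneg_right h2 (by positivity : (0 : ℚ) ≤ 2 * t + 2)
    have h5 : ((κ : ℤ) : ℚ) * (t + t / (2 * t + 2)) * (2 * t + 2) = κ * t * (2 * t + 3) := by
      push_cast
      field_simp
      ring
    linarith
  have h6 : (((d - 1) * (2 * t + 2) : ℕ) : ℚ) ≤ ((κ * t * (2 * t + 3) : ℕ) : ℚ) := by
    push_cast [Nat.cast_sub hd]
    exact h3
  exact_mod_cast h6

/-- Theorem 1.6. -/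
theorem stmt5 (K : Type) [Field K] [IsAlgClosed K] [CharZero K] (n d t : ℕ)
    (I : Ideal (MvPolynomial (Fin (n+1)) K))
    (hfin : IsFiniteSubscheme I) (hnd : NondegenerateScheme I)
    (hdeg : schemeDeg I = d) (ht : tInv I = t)
    (hlow : ⌈((d : ℚ) - 1) / ((t : ℚ) + (t : ℚ) / (2*(t : ℚ) + 2))⌉ + 2 < (schemeReg I : ℤ))
    (hhigh : (schemeReg I : ℤ) ≤ ⌈((d : ℚ) - n - 1) / (t : ℚ)⌉ + 2) :
    ∃! ΛC : Ideal (MvPolynomial (Fin (n+1)) K) × Ideal (MvPolynomial (Fin (n+1)) K),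
      IsLinearSubspace ΛC.1 t ∧ IsRNC t ΛC.2 ∧ ΛC.1 ≤ ΛC.2 ∧
      schemeReg (interIdeal I ΛC.2) = schemeReg I := by
  have ht1 : 1 ≤ t := by
    by_contra! h0
    obtain rfl : t = 0 := by omega
    simp only [Nat.cast_zero, zero_div, add_zero, div_zero, Int.ceil_zero] at hlow hhigh
    omega
  obtain ⟨A, _, _, ⟨E⟩⟩ := exists_affineModel hfin
  obtain ⟨d', hd'0, hd'⟩ := hfin.finite
  obtain ⟨M, hM⟩ := AffineModel.exists_U_eq_top (E := E) hd'
  have hA : FiniteDimensional K A := by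
    have := AffineModel.finiteDimensional_U (E := E) M
    rw [hM M le_rfl] at this
    exact Module.Finite.equiv Submodule.topEquiv
  have hdegA : schemeDeg I = Module.finrank K A := by
    rw [AffineModel.schemeDeg_eq AffineModel.hilbF_eq_quotDim_bot hM, finrank_quotient_bot]
  have hd0 : 1 ≤ d := by
    obtain ⟨m, hm, hm'⟩ := (hd'.and (eventually_ge_atTop M)).exists
    rw [AffineModel.hilbF_eq (E := E), hM m hm', finrank_top] at hm
    omega
  obtain ⟨κ, hκ, hdκ⟩ := regularity_bound hd0 ht1 hlow
  have hU : GeneralPosition E.U t := ht ▸ AffineModel.generalPosition hM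
  rw [← hdeg, hdegA] at hdκ
  have hreg : ∀ k, schemeReg I ≤ k + 1 ↔ E.U k = ⊤ := fun k => by
    rw [AffineModel.schemeReg_le_iff AffineModel.hilbF_eq_quotDim_bot hM]
    simp
  have hκ1 : E.U (κ + 1) ≠ ⊤ := fun h => by
    have := (hreg _).2 h
    omega
  have hκ2 : E.U (κ + 2) = ⊤ := (hreg _).1 hκ.le
  have hregC : ∀ p : Fin (n + 1) → MvPolynomial (Fin 2) K, (∀ i, (p i).IsHomogeneous t) →
      (schemeReg (interIdeal I (RingHom.ker (bind₁ p))) = schemeReg I ↔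
        E.U (κ + 1) ⊔ ((RingHom.ker (bind₁ p)).map E.ev).restrictScalars K ≠ ⊤) := by
    intro p hp
    have key := fun k => AffineModel.schemeReg_le_iff (AffineModel.hilbF_interIdeal (hM M le_rfl)
      (closedUnderComponents_ker_bind₁ ht1 hp)) hM (k := k)
    have h2 := (key (κ + 2)).2 (by rw [hκ2, top_sup_eq])
    rw [Ne, ← key, hκ]
    omega
  have hRNC : ∀ C : Ideal (MvPolynomial (Fin (n + 1)) K), IsRNC t C ↔
      ∃ p : Fin (n + 1) → MvPolynomial (Fin 2) K, (∀ i, (p i).IsHomogeneous t) ∧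
        Submodule.span K (Set.range p) = homogeneousSubmodule (Fin 2) K t ∧
        C = RingHom.ker (bind₁ p) := by
    intro C
    simp only [IsRNC, iInf_ker_eval_eq_ker_bind₁]
  obtain ⟨p, hp, hps, hpκ⟩ := AffineModel.exists_rationalNormalCurve hU ht1 hκ1 hdκ
  obtain ⟨hΛ, hΛC⟩ := (isLinearSubspace_and_le_ker_bind₁_iff hps).2 rfl
  refine ⟨⟨_, RingHom.ker (bind₁ p)⟩, ⟨hΛ, (hRNC _).2 ⟨p, hp, hps, rfl⟩, hΛC,
    (hregC p hp).2 hpκ⟩, ?_⟩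
  rintro ⟨Λ, C⟩ ⟨hΛ', hC', hle', hreg'⟩
  obtain ⟨p', hp', hps', rfl⟩ := (hRNC C).1 hC'
  obtain hC : RingHom.ker (bind₁ p') = RingHom.ker (bind₁ p) :=
    AffineModel.ker_bind₁_eq hU ht1 hdκ hp' hps' ((hregC p' hp').1 hreg') hp hps hpκ
  simp only at hΛ' hle'
  rw [hC] at hle'
  exact Prod.ext ((isLinearSubspace_and_le_ker_bind₁_iff hps).1 ⟨hΛ', hle'⟩) hC
end
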